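/- arXiv:2302.01750 — 2 statements merged into one kernel-verified Lean document; each statement's English description precedes it below -/
import Mathlib

section
/- Let p ≥ 5 be a prime and let r be an integer with 1 ≤ r ≤ p − 1 such that 24r + 1 is a quadratic nonresidue modulo p. Then for all integers n ≥ 0, i ≥ 1 and N ≥ 1, A_{p, p^N i − 1}(p n + r) ≡ 0 (mod p^N). -/
/-- Hook length of the cell in row `i`, column `j` (0-indexed) of the
Ferrers–Young diagram of the partition `p` (rows sorted in decreasing order). -/
def hookLength {n : ℕ} (p : n.Partition) (i j : ℕ) : ℕ :=
  (((p.parts.sort (· ≤ ·)).reverse.getD i 0 - j) +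
    ((p.parts.filter (fun x => j < x)).card - i)) - 1

/-- A partition is a `t`-core if no hook number of its Ferrers–Young diagram is
divisible by `t`. -/
def IsTCore (t : ℕ) {n : ℕ} (p : n.Partition) : Prop :=
  ∀ i j : ℕ, j < (p.parts.sort (· ≤ ·)).reverse.getD i 0 → ¬ t ∣ hookLength p i j

/-- `numA t k n` is the number of `k`-tuples of `t`-core partitions whose sizes sum to `n`. -/
noncomputable def numA (t k n : ℕ) : ℕ :=
  Nat.card { f : Fin k → Σ m : Fin (n + 1), Nat.Partition (m : ℕ) //
    (∑ i, ((f i).1 : ℕ)) = n ∧ ∀ i, IsTCore t (f i).2 }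

open PowerSeries in
theorem PowerSeries.pow_prime_eq_expand {p : ℕ} [Fact p.Prime] (f : (ZMod p)⟦X⟧) :
    f ^ p = expand p (Fact.out : p.Prime).ne_zero f := by
  have h := MvPowerSeries.map_frobenius_expand (σ := Unit) p (Fact.out : p.Prime).ne_zero (f := f)
  rw [ZMod.frobenius_zmod] at h
  exact h.symm.trans (congrFun (congrArg DFunLike.coe MvPowerSeries.map_id) _)

open PowerSeries in
theorem PowerSeries.natCast_dvd_of_map_eq_zero {p : ℕ} {f : ℤ⟦X⟧}
    (h : PowerSeries.map (Int.castRingHom (ZMod p)) f = 0) : (p : ℤ⟦X⟧) ∣ f := by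
  have h' : ∀ n, (p : ℤ) ∣ coeff n f := fun n => by
    have := congrArg (coeff n) h
    rwa [coeff_map, map_zero, eq_intCast, (ZMod.intCast_zmod_eq_zero_iff_dvd _ _)] at this
  choose g hg using h'
  refine ⟨PowerSeries.mk g, ?_⟩
  ext n
  rw [hg n, ← nsmul_eq_mul (p : ℕ) (PowerSeries.mk g), map_nsmul, coeff_mk, nsmul_eq_mul]

open PowerSeries in
theorem PowerSeries.pow_prime_pow_congr {p : ℕ} (hp : p.Prime) (f : ℤ⟦X⟧) {N : ℕ} (hN : 1 ≤ N) :
    (p ^ N : ℤ⟦X⟧) ∣ f ^ p ^ N - expand p hp.ne_zero (f ^ p ^ (N - 1)) := by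
  obtain ⟨M, rfl⟩ : ∃ M, N = M + 1 := ⟨N - 1, by omega⟩
  have := Fact.mk hp
  have h : (p : ℤ⟦X⟧) ∣ f ^ p - expand p hp.ne_zero f := by
    apply natCast_dvd_of_map_eq_zero
    rw [map_sub, map_pow, map_expand, pow_prime_eq_expand, sub_self]
  have := dvd_sub_pow_of_dvd_sub h M
  rwa [← pow_mul, mul_comm p, ← pow_succ, ← map_pow] at this

open PowerSeries in
theorem coeff_pentagonalSeries_mul_expand_eq_zero {p : ℕ} (hp : p.Prime) {r : ℕ}
    (hnr : ¬ IsSquare ((24 * r + 1 : ℕ) : ZMod p)) (W : ℤ⟦X⟧) (n : ℕ) :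
    coeff (p * n + r) (pentagonalSeries ℤ * expand p hp.ne_zero W) = 0 := by
  rw [coeff_mul]
  refine Finset.sum_eq_zero fun x hx => ?_
  rw [Finset.HasAntidiagonal.mem_antidiagonal] at hx
  by_cases hd : p ∣ x.2
  · rw [coeff_pentagonalSeries_eq_zero, zero_mul]
    rintro ⟨k, hk⟩
    apply hnr
    obtain ⟨d, hd⟩ := hd
    refine ⟨((6 * k - 1 : ℤ) : ZMod p), ?_⟩
    have h2 := two_mul_natCast_pentagonal k
    rw [hk] at h2
    have hx' : (x.1 : ℤ) = p * n + r - p * d := by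
      have : ((x.1 + x.2 : ℕ) : ℤ) = (p * n + r : ℕ) := by rw [hx]
      rw [hd] at this
      push_cast at this
      linarith
    have h3 : ((24 * r + 1 : ℕ) : ℤ) = (6 * k - 1) * (6 * k - 1) + p * (24 * (d - n)) := by
      push_cast
      linear_combination 12 * h2 - 24 * hx'
    have h4 := congrArg (Int.cast : ℤ → ZMod p) h3
    push_cast at h4 ⊢
    simpa using h4
  · rw [coeff_expand_of_not_dvd _ _ _ hd, mul_zero]

open PowerSeries in
theorem prime_pow_dvd_coeff_pow_of_mul_expand_eq {p : ℕ} (hp : p.Prime) {r : ℕ}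
    (hnr : ¬ IsSquare ((24 * r + 1 : ℕ) : ZMod p)) {P C Q : ℤ⟦X⟧}
    (hP : P * pentagonalSeries ℤ = 1) (hC : C * expand p hp.ne_zero Q = P)
    (n : ℕ) {i N : ℕ} (hi : 1 ≤ i) (hN : 1 ≤ N) :
    (p ^ N : ℤ) ∣ coeff (p * n + r) (C ^ (p ^ N * i - 1)) := by
  have hQ : IsUnit Q := by
    rw [isUnit_iff_constantCoeff]
    have h1 : IsUnit (expand p hp.ne_zero Q) :=
      isUnit_of_mul_isUnit_right (hC ▸ IsUnit.of_mul_eq_one _ hP)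
    rwa [isUnit_iff_constantCoeff, constantCoeff_expand] at h1
  obtain ⟨Q', hQ'⟩ := hQ.exists_right_inv
  have hC' : C = P * expand p hp.ne_zero Q' := by
    rw [← hC, mul_assoc, ← map_mul, hQ', map_one, mul_one]
  have hk : p ^ N * i - 1 + 1 = p ^ N * i :=
    Nat.sub_add_cancel (Nat.mul_pos (pow_pos hp.pos _) hi)
  have hPk : P ^ (p ^ N * i - 1) = pentagonalSeries ℤ * (P ^ p ^ N) ^ i := by
    rw [← pow_mul]
    nth_rw 2 [← hk]
    rw [pow_succ]
    linear_combination (-(P ^ (p ^ N * i - 1))) * hP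
  obtain ⟨R, hR⟩ := (pow_prime_pow_congr hp P hN).trans (sub_dvd_pow_sub_pow _ _ i)
  rw [hC', mul_pow, hPk, sub_eq_iff_eq_add.1 hR, ← map_pow, ← map_pow, mul_add, add_mul,
    mul_assoc (pentagonalSeries ℤ) (expand p _ _), ← map_mul, map_add,
    coeff_pentagonalSeries_mul_expand_eq_zero hp hnr, add_zero]
  have : (p ^ N : ℤ⟦X⟧) = PowerSeries.C (p ^ N : ℤ) := by simp
  rw [this, mul_left_comm, mul_assoc, coeff_C_mul]
  exact dvd_mul_right _ _

open PowerSeries PowerSeries.WithPiTopology in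
theorem partition_series_mul_pentagonalSeries :
    (PowerSeries.mk fun n => (Fintype.card n.Partition : ℤ)) * pentagonalSeries ℤ = 1 := by
  have h1 := Nat.Partition.hasProd_powerSeriesMk_card_restricted ℤ (fun _ => True)
  have h2 := hasProd_one_sub_X_pow ℤ
  have h3 := h1.mul h2
  have h4 : ∀ i : ℕ, (if True then ∑' j : ℕ, (X : ℤ⟦X⟧) ^ ((i + 1) * j) else 1) *
      (1 - X ^ (i + 1)) = 1 := by
    intro i
    simp only [if_true, pow_mul]
    exact tsum_pow_mul_one_sub_of_constantCoeff_eq_zero (by simp)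
  simp only [h4] at h3
  have h5 := h3.unique hasProd_one
  simpa [Nat.Partition.restricted, Finset.card_univ] using h5

/-- `F` is the generating series counting the elements of `α` by their weight `w`, each weight
being attained finitely often. -/
def IsGenSeries {α : Type*} (w : α → ℕ) (F : PowerSeries ℤ) : Prop :=
  ∀ n, Finite {a // w a = n} ∧ PowerSeries.coeff n F = Nat.card {a // w a = n}

namespace IsGenSeries

variable {α β : Type*} {w : α → ℕ} {v : β → ℕ} {F G : PowerSeries ℤ}

theorem eq (h : IsGenSeries w F) (h' : IsGenSeries w G) : F = G := by
  ext n
  rw [(h n).2, (h' n).2]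

theorem of_equiv (h : IsGenSeries w F) (e : α ≃ β) (he : ∀ a, v (e a) = w a) :
    IsGenSeries v F := by
  intro n
  have e' : {a // w a = n} ≃ {b // v b = n} := e.subtypeEquiv fun a => by rw [he]
  have := (h n).1
  exact ⟨Finite.of_equiv _ e', by rw [(h n).2, Nat.card_congr e']⟩

theorem of_finite (h : ∀ n, Finite {a // w a = n}) :
    IsGenSeries w (PowerSeries.mk fun n => (Nat.card {a // w a = n} : ℤ)) :=
  fun n => ⟨h n, PowerSeries.coeff_mk _ _⟩

theorem subtype (h : IsGenSeries w F) (q : α → Prop) :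
    IsGenSeries (fun a : {a // q a} => w a)
      (PowerSeries.mk fun n => (Nat.card {a : {a // q a} // w a = n} : ℤ)) := by
  refine of_finite fun n => ?_
  have := (h n).1
  exact Finite.of_injective (fun a => (⟨a.1.1, a.2⟩ : {a // w a = n})) fun a b hab =>
    Subtype.ext (Subtype.ext (Subtype.mk.inj hab))

theorem prod (h : IsGenSeries w F) (h' : IsGenSeries v G) :
    IsGenSeries (fun x : α × β => w x.1 + v x.2) (F * G) := by
  intro n
  let e : {x : α × β // w x.1 + v x.2 = n} ≃
      Σ ij : Finset.HasAntidiagonal.antidiagonal n, {a // w a = ij.1.1} × {b // v b = ij.1.2} :=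
    { toFun := fun x => ⟨⟨(w x.1.1, v x.1.2), by simpa using x.2⟩, ⟨x.1.1, rfl⟩, ⟨x.1.2, rfl⟩⟩
      invFun := fun y => ⟨(y.2.1.1, y.2.2.1), by
        have := y.1.2
        rw [Finset.HasAntidiagonal.mem_antidiagonal] at this
        rw [y.2.1.2, y.2.2.2, this]⟩
      left_inv := fun x => rfl
      right_inv := by
        rintro ⟨⟨⟨i, j⟩, hij⟩, ⟨a, ha⟩, ⟨b, hb⟩⟩
        dsimp only at ha hb
        subst ha hb
        rfl }
  have := fun i => (h i).1
  have := fun i => (h' i).1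
  refine ⟨Finite.of_equiv _ e.symm, ?_⟩
  rw [Nat.card_congr e, Nat.card_sigma, PowerSeries.coeff_mul]
  push_cast
  rw [← Finset.sum_coe_sort]
  refine Finset.sum_congr rfl fun x _ => ?_
  rw [Nat.card_prod, (h _).2, (h' _).2, Nat.cast_mul]

theorem pow (h : IsGenSeries w F) (k : ℕ) :
    IsGenSeries (fun f : Fin k → α => ∑ i, w (f i)) (F ^ k) := by
  induction k with
  | zero =>
    intro n
    refine ⟨inferInstance, ?_⟩
    rw [pow_zero, PowerSeries.coeff_one]
    split_ifs with hn
    · subst hn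
      simp
    · have : IsEmpty {f : Fin 0 → α // ∑ i, w (f i) = n} := ⟨fun f => hn (by simpa using f.2.symm)⟩
      rw [Nat.card_of_isEmpty, Nat.cast_zero]
  | succ k ih =>
    rw [pow_succ']
    refine (h.prod ih).of_equiv (Fin.consEquiv fun _ => α) fun a => ?_
    simp [Fin.sum_univ_succ, Fin.consEquiv]

theorem expand (h : IsGenSeries w F) {t : ℕ} (ht : t ≠ 0) :
    IsGenSeries (fun a => t * w a) (PowerSeries.expand t ht F) := by
  intro n
  rw [PowerSeries.coeff_expand]
  split_ifs with hn
  · obtain ⟨m, rfl⟩ := hn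
    rw [Nat.mul_div_cancel_left _ (Nat.pos_of_ne_zero ht)]
    simpa [ht] using h m
  · have : IsEmpty {a // t * w a = n} := ⟨fun a => hn ⟨_, a.2.symm⟩⟩
    exact ⟨inferInstance, by simp⟩

end IsGenSeries

/-- Partitions of arbitrary size, as weakly decreasing finitely supported sequences of row
lengths. -/
abbrev RowSeq : Type := {f : ℕ →₀ ℕ // Antitone f}

namespace RowSeq

/-- The number of cells. -/
def size (f : RowSeq) : ℕ := f.1.sum fun _ x => x

instance : Zero RowSeq := ⟨⟨0, fun _ _ _ => le_rfl⟩⟩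

theorem zero_apply (i : ℕ) : (0 : RowSeq).1 i = 0 := rfl

theorem size_zero : size 0 = 0 := by
  simp [size, show (0 : RowSeq).1 = 0 from rfl]

theorem exists_bound (f : RowSeq) : ∃ L, ∀ i, L ≤ i → f.1 i = 0 := by
  refine ⟨f.1.support.sup id + 1, fun i hi => ?_⟩
  by_contra h
  have := Finset.le_sup (f := id) (Finsupp.mem_support_iff.2 h)
  simp only [id] at this
  omega

theorem size_eq_sum_range (f : RowSeq) {L : ℕ} (hL : ∀ i, L ≤ i → f.1 i = 0) :
    f.size = ∑ i ∈ Finset.range L, f.1 i := by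
  refine Finsupp.sum_of_support_subset _ (fun i hi => ?_) _ fun _ _ => rfl
  by_contra h
  exact Finsupp.mem_support_iff.1 hi (hL i (by simpa using h))

theorem exists_le (f : RowSeq) (j : ℕ) : ∃ i, f.1 i ≤ j :=
  let ⟨L, hL⟩ := f.exists_bound
  ⟨L, by simp [hL L le_rfl]⟩

/-- The length of column `j`. -/
def col (f : RowSeq) (j : ℕ) : ℕ := Nat.find (f.exists_le j)

theorem lt_col_iff (f : RowSeq) (i j : ℕ) : i < f.col j ↔ j < f.1 i := by
  rw [col, Nat.lt_find_iff]
  constructor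
  · intro h
    exact not_le.1 (h i le_rfl)
  · intro h m hm
    exact not_le.2 (h.trans_le (f.2 hm))

/-- The `t`-core condition in terms of row and column lengths. -/
def IsCore (t : ℕ) (f : RowSeq) : Prop :=
  ∀ i j, j < f.1 i → ¬ t ∣ ((f.1 i - j) + (f.col j - i)) - 1

/-- The position of the `i`-th bead, from the top, in the Maya diagram of charge `c`. -/
def bead (x : ℤ × RowSeq) (i : ℕ) : ℤ := x.2.1 i - i - 1 + x.1

theorem bead_strictAnti (x : ℤ × RowSeq) : StrictAnti (bead x) := by
  refine strictAnti_nat_of_succ_lt fun n => ?_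
  have := x.2.2 (Nat.le_succ n)
  simp only [bead, Nat.succ_eq_add_one] at *
  push_cast
  omega

/-- The set of beads of the Maya diagram of charge `c`. -/
def maya (x : ℤ × RowSeq) : Set ℤ := Set.range (bead x)

theorem notMem_maya_iff (x : ℤ × RowSeq) (y : ℤ) :
    y ∉ maya x ↔ ∃ j : ℕ, y = j - x.2.col j + x.1 := by
  constructor
  · intro hy
    obtain ⟨L, hL⟩ := x.2.exists_bound
    have hex : ∃ i, bead x i ≤ y := by
      refine ⟨L + (x.1 - y).toNat, ?_⟩
      rw [bead, hL _ (Nat.le_add_right _ _)]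
      push_cast
      omega
    classical
    set i := Nat.find hex with hi
    have h1 : bead x i < y := lt_of_le_of_ne (Nat.find_spec hex) fun h => hy ⟨i, h⟩
    have h2 : ∀ k < i, y < bead x k := fun k hk => not_le.1 (Nat.find_min hex hk)
    clear_value i
    simp only [bead] at h1 h2
    have h3 : 0 ≤ y - x.1 + i := by omega
    obtain ⟨j, hj⟩ := Int.eq_ofNat_of_zero_le h3
    have h4 : x.2.col j = i := by
      refine eq_of_forall_lt_iff fun k => ?_
      rw [lt_col_iff]
      constructor
      · intro h
        by_contra hk
        have := x.2.2 (not_lt.1 hk)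
        omega
      · intro hk
        have := h2 (i - 1) (by omega)
        have := x.2.2 (show k ≤ i - 1 by omega)
        omega
    exact ⟨j, by omega⟩
  · rintro ⟨j, rfl⟩ ⟨i, hi⟩
    have := x.2.lt_col_iff i j
    simp only [bead] at hi
    omega

theorem isCore_iff {t : ℕ} (ht : 0 < t) (f : RowSeq) :
    IsCore t f ↔ ∀ y ∈ maya (0, f), y - t ∈ maya (0, f) := by
  constructor
  · rintro h y ⟨i, rfl⟩
    by_contra hy
    obtain ⟨j, hj⟩ := (notMem_maya_iff _ _).1 hy
    simp only [bead] at hj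
    have h1 := f.lt_col_iff i j
    have h2 : j < f.1 i := by omega
    refine h i j h2 ?_
    have : ((f.1 i - j) + (f.col j - i)) - 1 = t := by omega
    rw [this]
  · rintro h i j hij ⟨k, hk⟩
    have h1 := (f.lt_col_iff i j).2 hij
    have h2 : ∀ k : ℕ, bead (0, f) i - t * k ∈ maya (0, f) := by
      intro k
      induction k with
      | zero => exact ⟨i, by simp⟩
      | succ k ih =>
        have := h _ ih
        rwa [sub_sub, ← mul_add_one] at this
    refine (notMem_maya_iff (0, f) _).2 ⟨j, ?_⟩ (h2 k)
    have h3 : ((f.1 i : ℤ) - j + (f.col j - i)) - 1 = t * k := by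
      rw [← Nat.cast_mul, ← hk]
      omega
    rw [← h3, bead]
    ring

theorem maya_injective : Function.Injective maya := by
  intro x y h
  have hb : bead x = bead y := by
    have := (StrictMono.range_inj (f := fun i => OrderDual.toDual (bead x i))
      (g := fun i => OrderDual.toDual (bead y i))
      (fun _ _ h => bead_strictAnti x h) (fun _ _ h => bead_strictAnti y h)).1 h
    exact this
  obtain ⟨L, hL⟩ := x.2.exists_bound
  obtain ⟨L', hL'⟩ := y.2.exists_bound
  have hc : x.1 = y.1 := by
    have := congrFun hb (max L L')
    simpa [bead, hL _ (le_max_left _ _), hL' _ (le_max_right _ _)] using this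
  refine Prod.ext hc (Subtype.ext (Finsupp.ext fun i => ?_))
  have := congrFun hb i
  simp only [bead, hc] at this
  omega

theorem maya_bddAbove (x : ℤ × RowSeq) : BddAbove (maya x) := by
  refine ⟨bead x 0, ?_⟩
  rintro _ ⟨i, rfl⟩
  exact (bead_strictAnti x).antitone (Nat.zero_le i)

theorem maya_compl_bddBelow (x : ℤ × RowSeq) : BddBelow (maya x)ᶜ := by
  obtain ⟨L, hL⟩ := x.2.exists_bound
  refine ⟨x.1 - L, fun y hy => ?_⟩
  by_contra h
  refine hy ⟨(x.1 - 1 - y).toNat, ?_⟩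
  rw [bead, hL _ (by omega)]
  omega

theorem exists_bead_eq {e : ℕ → ℤ} (he : StrictAnti e) {a : ℤ}
    (ha : ∀ y < a, y ∈ Set.range e) : ∃ x, bead x = e := by
  have hstep : ∀ i j, i ≤ j → e j + j ≤ e i + i := by
    intro i j hij
    induction j, hij using Nat.le_induction with
    | base => rfl
    | succ j _ ih =>
      have : e (j + 1) < e j := he (Nat.lt_succ_self j)
      push_cast at *
      omega
  obtain ⟨L, hL⟩ : ∃ L, e L < a := by
    obtain ⟨i, hi⟩ := ha (a - 1) (by omega)
    exact ⟨i, by omega⟩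
  have hconst : ∀ j, L ≤ j → e j + j = e L + L := by
    intro j hj
    induction j, hj using Nat.le_induction with
    | base => rfl
    | succ j hj ih =>
      have hjL := he.antitone hj
      obtain ⟨k, hk⟩ := ha (e j - 1) (by omega)
      have hk1 : j < k := he.lt_iff_gt.1 (by omega)
      have h1 : e k ≤ e (j + 1) := he.antitone (Nat.succ_le_of_lt hk1)
      have h2 : e (j + 1) < e j := he (Nat.lt_succ_self j)
      push_cast
      omega
  have hnonneg : ∀ i, e L + L ≤ e i + i := fun i => by
    rcases le_total i L with h | h
    · exact hstep i L h
    · exact (hconst i h).ge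
  let f : ℕ →₀ ℕ := Finsupp.onFinset (Finset.range L) (fun i => (e i + i - (e L + L)).toNat)
    fun i hi => by
      by_contra h
      have := hconst i (by simpa using h)
      simp only [this] at hi
      omega
  have hf : ∀ i, f i = (e i + i - (e L + L)).toNat := fun i => rfl
  have hanti : Antitone f := fun i j hij => by
    have := hstep i j hij
    rw [hf, hf]
    omega
  refine ⟨(e L + L + 1, ⟨f, hanti⟩), ?_⟩
  ext i
  have := hnonneg i
  simp only [bead, hf]
  omega

theorem exists_maya_eq {S : Set ℤ} (h : BddAbove S) (h' : BddBelow Sᶜ) : ∃ x, maya x = S := by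
  obtain ⟨b, hb⟩ := h
  obtain ⟨a, ha⟩ := h'
  have ha' : ∀ y < a, y ∈ S := fun y hy => by
    by_contra hS
    exact absurd (ha hS) (not_le.2 hy)
  let q : ℕ → Prop := fun n => b - n ∈ S
  have hinf : (Set.ofPred q).Infinite := by
    refine Set.infinite_of_forall_exists_gt fun n => ?_
    exact ⟨n + (b - a).toNat + 1, ha' _ (by push_cast; omega), by omega⟩
  let e : ℕ → ℤ := fun i => b - (Nat.nth q i : ℕ)
  have he : StrictAnti e := fun i j hij => by
    have := Nat.nth_strictMono hinf hij
    simp only [e]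
    omega
  have hrange : Set.range e = S := by
    ext y
    constructor
    · rintro ⟨i, rfl⟩
      exact Nat.nth_mem_of_infinite hinf i
    · intro hy
      have hyb : y ≤ b := hb hy
      have : q (b - y).toNat := by
        simp only [q]
        rwa [Int.toNat_of_nonneg (by omega), sub_sub_cancel]
      obtain ⟨i, hi⟩ : (b - y).toNat ∈ Set.range (Nat.nth q) := by
        rw [Nat.range_nth_of_infinite hinf]
        exact this
      refine ⟨i, ?_⟩
      simp only [e, hi]
      omega
  obtain ⟨x, hx⟩ := exists_bead_eq he fun y hy => hrange ▸ ha' y hy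
  exact ⟨x, by rw [maya, hx, hrange]⟩

/-- A Maya diagram of charge `c` with the given row lengths is empty iff moving every bead down
by one is allowed. -/
theorem eq_zero_iff (x : ℤ × RowSeq) : x.2 = 0 ↔ ∀ y ∈ maya x, y - 1 ∈ maya x := by
  constructor
  · rintro hx y ⟨i, rfl⟩
    refine ⟨i + 1, ?_⟩
    simp only [bead, hx, zero_apply]
    push_cast
    ring
  · intro h
    have hstep : ∀ i, x.2.1 i ≤ x.2.1 (i + 1) := by
      intro i
      obtain ⟨k, hk⟩ := h _ ⟨i, rfl⟩
      have hik : i < k := (bead_strictAnti x).lt_iff_gt.1 (by omega)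
      have h1 := (bead_strictAnti x).antitone (Nat.succ_le_of_lt hik)
      rw [hk] at h1
      simp only [bead, Nat.succ_eq_add_one] at h1
      push_cast at h1
      omega
    obtain ⟨L, hL⟩ := x.2.exists_bound
    have hm : Monotone x.2.1 := monotone_nat_of_le_succ hstep
    refine Subtype.ext (Finsupp.ext fun i => ?_)
    have h1 := hm (le_max_left i L)
    rw [hL _ (le_max_right i L)] at h1
    rw [zero_apply]
    omega

/-- The beads at height at least `-K`. -/
def upperBeads (x : ℤ × RowSeq) (K : ℕ) : Finset ℤ :=
  (Finset.range (K + x.1).toNat).image (bead x)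

theorem eventually_mem_upperBeads_iff (x : ℤ × RowSeq) :
    ∀ᶠ K : ℕ in Filter.atTop, ∀ y, y ∈ upperBeads x K ↔ y ∈ maya x ∧ -(K : ℤ) ≤ y := by
  obtain ⟨L, hL⟩ := x.2.exists_bound
  filter_upwards [Filter.eventually_ge_atTop (L + x.1.natAbs)] with K hK y
  simp only [upperBeads, Finset.mem_image, Finset.mem_range, maya, Set.mem_range]
  constructor
  · rintro ⟨i, hi, rfl⟩
    refine ⟨⟨i, rfl⟩, ?_⟩
    rw [bead]
    omega
  · rintro ⟨⟨i, rfl⟩, hi⟩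
    refine ⟨i, ?_, rfl⟩
    by_contra hc
    rw [bead, hL i (by omega)] at hi
    omega

theorem sum_upperBeads (x : ℤ × RowSeq) (K : ℕ) (g : ℤ → ℤ) :
    ∑ y ∈ upperBeads x K, g y = ∑ i ∈ Finset.range (K + x.1).toNat, g (bead x i) :=
  Finset.sum_image (bead_strictAnti x).injective.injOn

theorem eventually_sum_bead (x : ℤ × RowSeq) :
    ∀ᶠ K : ℕ in Filter.atTop, ∑ i ∈ Finset.range (K + x.1).toNat, bead x i =
      x.2.size + ∑ i ∈ Finset.range (K + x.1).toNat, (-(i : ℤ) - 1 + x.1) := by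
  obtain ⟨L, hL⟩ := x.2.exists_bound
  filter_upwards [Filter.eventually_ge_atTop (L + x.1.natAbs)] with K hK
  rw [x.2.size_eq_sum_range (L := (K + x.1).toNat) fun i hi => hL i (by omega)]
  push_cast
  rw [← Finset.sum_add_distrib]
  refine Finset.sum_congr rfl fun i _ => ?_
  rw [bead]
  ring

/-- Beads on runner `j` of the abacus with `t` runners. -/
def runner (t : ℕ) (S : Set ℤ) (j : ℕ) : Set ℤ := {y | t * y + j ∈ S}

theorem exists_maya_eq_runner {t : ℕ} (ht : 0 < t) (x : ℤ × RowSeq) (j : ℕ) :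
    ∃ y, maya y = runner t (maya x) j := by
  have ht' : (1 : ℤ) ≤ t := by exact_mod_cast ht
  apply exists_maya_eq
  · obtain ⟨b, hb⟩ := maya_bddAbove x
    refine ⟨|b|, fun y hy => ?_⟩
    have h1 : t * y + j ≤ b := hb hy
    have h2 := le_abs_self b
    by_contra h
    nlinarith [abs_nonneg b]
  · obtain ⟨a, ha⟩ := maya_compl_bddBelow x
    refine ⟨-|a| - j, fun y hy => ?_⟩
    have h1 : a ≤ t * y + j := ha hy
    have h2 := neg_abs_le a
    by_contra h
    nlinarith [abs_nonneg a]

theorem mul_add_emod_ediv {t : ℕ} (u : ℤ) (j : Fin t) :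
    (t * u + j) / t = u ∧ (t * u + j) % t = j := by
  have h1 : (0 : ℤ) < t := by exact_mod_cast j.pos
  have h2 : (j : ℤ) < t := by exact_mod_cast j.2
  have h3 : (0 : ℤ) ≤ j := by positivity
  constructor
  · rw [Int.mul_add_ediv_left _ _ h1.ne', Int.ediv_eq_zero_of_lt h3 h2, add_zero]
  · rw [Int.mul_add_emod_self_left, Int.emod_eq_of_lt h3 h2]

theorem exists_eq_mul_add {t : ℕ} (ht : 0 < t) (z : ℤ) :
    ∃ (u : ℤ) (j : Fin t), z = t * u + j := by
  have h1 : (0 : ℤ) < t := by exact_mod_cast ht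
  have h2 := Int.emod_nonneg z h1.ne'
  have h3 := Int.emod_lt_of_pos z h1
  refine ⟨z / t, ⟨(z % t).toNat, by omega⟩, ?_⟩
  simp only [Int.toNat_of_nonneg h2]
  exact (Int.mul_ediv_add_emod z t).symm

theorem exists_runner_eq_maya {t : ℕ} (ht : 0 < t) (y : Fin t → ℤ × RowSeq) :
    ∃ x, ∀ j : Fin t, runner t (maya x) j = maya (y j) := by
  have ht' : (1 : ℤ) ≤ t := by exact_mod_cast ht
  choose b hb using fun j => maya_bddAbove (y j)
  choose a ha using fun j => maya_compl_bddBelow (y j)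
  obtain ⟨B, hB⟩ := (Set.finite_range b).bddAbove
  obtain ⟨A, hA⟩ := (Set.finite_range a).bddBelow
  let S : Set ℤ := {z | ∃ (j : Fin t) (u : ℤ), u ∈ maya (y j) ∧ z = t * u + j}
  have hS : ∀ (u : ℤ) (j : Fin t), t * u + j ∈ S ↔ u ∈ maya (y j) := by
    intro u j
    constructor
    · rintro ⟨j', u', hu', h⟩
      have h1 := mul_add_emod_ediv u j
      have h2 := mul_add_emod_ediv u' j'
      rw [h] at h1
      have h3 : u = u' := h1.1.symm.trans h2.1
      have h4 : j = j' := by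
        have := h1.2.symm.trans h2.2
        exact Fin.ext (by exact_mod_cast this)
      rwa [h3, h4]
    · exact fun h => ⟨j, u, h, rfl⟩
  obtain ⟨x, hx⟩ := exists_maya_eq (S := S)
    (by
      refine ⟨t * B + t, ?_⟩
      rintro _ ⟨j, u, hu, rfl⟩
      have h1 : u ≤ B := (hb j hu).trans (hB ⟨j, rfl⟩)
      have h2 : (j : ℤ) < t := by exact_mod_cast j.2
      nlinarith)
    (by
      refine ⟨t * A, fun z hz => ?_⟩
      obtain ⟨u, j, rfl⟩ := exists_eq_mul_add ht z
      have h1 : A ≤ u := (hA ⟨j, rfl⟩).trans (ha j fun h => hz ((hS u j).2 h))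
      have h2 : (0 : ℤ) ≤ j := by positivity
      nlinarith)
  refine ⟨x, fun j => ?_⟩
  ext u
  rw [hx]
  exact hS u j

theorem existsUnique_runner_eq_maya {t : ℕ} (ht : 0 < t) (y : Fin t → ℤ × RowSeq) :
    ∃! x, ∀ j : Fin t, runner t (maya x) j = maya (y j) := by
  obtain ⟨x, hx⟩ := exists_runner_eq_maya ht y
  refine ⟨x, hx, fun x' hx' => maya_injective ?_⟩
  ext z
  obtain ⟨u, j, rfl⟩ := exists_eq_mul_add ht z
  exact Set.ext_iff.1 ((hx' j).trans (hx j).symm) u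

/-- The decomposition of a Maya diagram into the diagrams on the runners of the `t`-abacus. -/
noncomputable def abacus {t : ℕ} (ht : 0 < t) : (ℤ × RowSeq) ≃ (Fin t → ℤ × RowSeq) where
  toFun x j := (exists_maya_eq_runner ht x j).choose
  invFun y := (existsUnique_runner_eq_maya ht y).choose
  left_inv x := ((existsUnique_runner_eq_maya ht _).choose_spec.2 x fun j =>
    (exists_maya_eq_runner ht x j).choose_spec.symm).symm
  right_inv y := funext fun j => maya_injective <|
    (exists_maya_eq_runner ht _ j).choose_spec.trans
      ((existsUnique_runner_eq_maya ht y).choose_spec.1 j)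

theorem mem_maya_abacus_iff {t : ℕ} (ht : 0 < t) (x : ℤ × RowSeq) (j : Fin t) (u : ℤ) :
    u ∈ maya (abacus ht x j) ↔ t * u + j ∈ maya x :=
  Set.ext_iff.1 (exists_maya_eq_runner ht x j).choose_spec u

theorem eventually_sum_upperBeads_abacus {t : ℕ} (ht : 0 < t) (x : ℤ × RowSeq) :
    ∀ᶠ K : ℕ in Filter.atTop, ∀ g : ℤ → ℤ, ∑ y ∈ upperBeads x (t * K), g y =
      ∑ j : Fin t, ∑ u ∈ upperBeads (abacus ht x j) K, g (t * u + j) := by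
  have htend : Filter.Tendsto (fun K => t * K) Filter.atTop Filter.atTop :=
    Filter.tendsto_id.const_mul_atTop' ht
  have ht' : (0 : ℤ) < t := by exact_mod_cast ht
  filter_upwards [htend.eventually (eventually_mem_upperBeads_iff x), Filter.eventually_all.2
    fun j => eventually_mem_upperBeads_iff (abacus ht x j)] with K h1 h2 g
  rw [Finset.sum_sigma']
  symm
  have hK : ∀ (u : ℤ) (j : Fin t), -((t * K : ℕ) : ℤ) ≤ t * u + j ↔ -(K : ℤ) ≤ u := by
    intro u j
    have h3 : (j : ℤ) < t := by exact_mod_cast j.2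
    have h4 : (0 : ℤ) ≤ j := by positivity
    push_cast
    constructor
    · intro h
      by_contra hc
      nlinarith
    · intro h
      nlinarith
  refine Finset.sum_bij (fun a _ => t * a.2 + a.1) ?_ ?_ ?_ fun _ _ => rfl
  · rintro ⟨j, u⟩ hu
    rw [Finset.mem_sigma, h2, mem_maya_abacus_iff] at hu
    rw [h1, hK]
    exact hu.2
  · rintro ⟨j, u⟩ _ ⟨j', u'⟩ _ h
    have h3 := mul_add_emod_ediv u j
    have h4 := mul_add_emod_ediv u' j'
    dsimp only at h
    rw [h] at h3
    obtain rfl : u = u' := h3.1.symm.trans h4.1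
    obtain rfl : j = j' := Fin.ext (by exact_mod_cast h3.2.symm.trans h4.2)
    rfl
  · intro z hz
    obtain ⟨u, j, rfl⟩ := exists_eq_mul_add ht z
    rw [h1, hK] at hz
    refine ⟨⟨j, u⟩, ?_, rfl⟩
    rw [Finset.mem_sigma, h2, mem_maya_abacus_iff]
    exact ⟨Finset.mem_univ _, hz⟩

theorem sum_abacus_fst {t : ℕ} (ht : 0 < t) (x : ℤ × RowSeq) :
    ∑ j, (abacus ht x j).1 = x.1 := by
  have h := (eventually_sum_upperBeads_abacus ht x).and
    ((Filter.eventually_ge_atTop x.1.natAbs).and (Filter.eventually_all.2 fun j =>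
      Filter.eventually_ge_atTop (abacus ht x j).1.natAbs))
  obtain ⟨K, h1, h2, h3⟩ := h.exists
  have h4 := h1 fun _ => 1
  simp only [sum_upperBeads] at h4
  simp only [Finset.sum_const, Finset.card_range, nsmul_eq_mul, mul_one] at h4
  have h5 : K ≤ t * K := Nat.le_mul_of_pos_left K ht
  rw [Int.natCast_toNat_eq_self.2 (by omega), Finset.sum_congr rfl fun j _ =>
    Int.natCast_toNat_eq_self.2 (show 0 ≤ (K : ℤ) + (abacus ht x j).1 by have := h3 j; omega),
    Finset.sum_add_distrib] at h4
  simp only [Finset.sum_const, Finset.card_univ, Fintype.card_fin, nsmul_eq_mul] at h4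
  push_cast at h4
  linarith

theorem eventually_size_abacus {t : ℕ} (ht : 0 < t) (x : ℤ × RowSeq) :
    ∀ᶠ K : ℕ in Filter.atTop,
      x.2.size + ∑ i ∈ Finset.range ((t * K : ℕ) + x.1).toNat, (-(i : ℤ) - 1 + x.1) =
        t * ∑ j, ((abacus ht x j).2.size : ℤ) + ∑ j : Fin t,
          ∑ i ∈ Finset.range (K + (abacus ht x j).1).toNat,
            (t * (-(i : ℤ) - 1 + (abacus ht x j).1) + j) := by
  have htend : Filter.Tendsto (fun K => t * K) Filter.atTop Filter.atTop :=
    Filter.tendsto_id.const_mul_atTop' ht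
  filter_upwards [eventually_sum_upperBeads_abacus ht x, htend.eventually (eventually_sum_bead x),
    Filter.eventually_all.2 fun j => eventually_sum_bead (abacus ht x j)] with K h1 h2 h3
  have h4 := h1 id
  simp only [sum_upperBeads, id] at h4
  rw [← h2, h4, Finset.mul_sum, ← Finset.sum_add_distrib]
  refine Finset.sum_congr rfl fun j _ => ?_
  simp only [Finset.sum_add_distrib (f := fun i => (t : ℤ) * _), ← Finset.mul_sum]
  rw [h3 j]
  ring

theorem size_eq_of_abacus_fst_eq {t : ℕ} (ht : 0 < t) {x y : ℤ × RowSeq}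
    (h : ∀ j, (abacus ht x j).1 = (abacus ht y j).1) (hy : ∀ j, (abacus ht y j).2 = 0) :
    x.2.size = y.2.size + t * ∑ j, (abacus ht x j).2.size := by
  obtain ⟨K, h1, h2⟩ := ((eventually_size_abacus ht x).and (eventually_size_abacus ht y)).exists
  have hxy : x.1 = y.1 := by
    rw [← sum_abacus_fst ht x, ← sum_abacus_fst ht y]
    exact Finset.sum_congr rfl fun j _ => h j
  simp only [hy, size_zero, ← h, ← hxy, Nat.cast_zero, Finset.sum_const_zero, mul_zero,
    zero_add] at h2
  have h3 : (x.2.size : ℤ) = y.2.size + t * ∑ j, ((abacus ht x j).2.size : ℤ) := by linarith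
  exact_mod_cast h3

theorem isCore_iff_abacus {t : ℕ} (ht : 0 < t) (f : RowSeq) :
    IsCore t f ↔ ∀ j, (abacus ht (0, f) j).2 = 0 := by
  simp only [isCore_iff ht, eq_zero_iff, mem_maya_abacus_iff]
  constructor
  · intro h j u hu
    have := h _ hu
    rwa [show (t : ℤ) * (u - 1) + j = t * u + j - t by ring]
  · intro h z hz
    obtain ⟨u, j, rfl⟩ := exists_eq_mul_add ht z
    have := h j u hz
    rwa [show (t : ℤ) * (u - 1) + j = t * u + j - t by ring] at this

/-- The diagram with the given runner charges and runner rows. -/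
noncomputable def ofRunners {t : ℕ} (ht : 0 < t) (c : Fin t → ℤ) (q : Fin t → RowSeq) : RowSeq :=
  ((abacus ht).symm fun j => (c j, q j)).2

theorem abacus_ofRunners {t : ℕ} (ht : 0 < t) {c : Fin t → ℤ} (hc : ∑ j, c j = 0)
    (q : Fin t → RowSeq) : abacus ht (0, ofRunners ht c q) = fun j => (c j, q j) := by
  have h : ((abacus ht).symm fun j => (c j, q j)).1 = 0 := by
    rw [← sum_abacus_fst ht, Equiv.apply_symm_apply]
    exact hc
  rw [ofRunners, ← h, Prod.mk.eta, Equiv.apply_symm_apply]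

theorem ofRunners_abacus {t : ℕ} (ht : 0 < t) (f : RowSeq) :
    ofRunners ht (fun j => (abacus ht (0, f) j).1) (fun j => (abacus ht (0, f) j).2) = f := by
  simp [ofRunners]

/-- The bijection between partitions and pairs of a `t`-core and a `t`-quotient. -/
noncomputable def coreQuotientEquiv {t : ℕ} (ht : 0 < t) :
    RowSeq ≃ {f : RowSeq // IsCore t f} × (Fin t → RowSeq) where
  toFun f := ⟨⟨ofRunners ht (fun j => (abacus ht (0, f) j).1) 0, by
    rw [isCore_iff_abacus ht, abacus_ofRunners ht (sum_abacus_fst ht _)]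
    exact fun _ => rfl⟩, fun j => (abacus ht (0, f) j).2⟩
  invFun y := ofRunners ht (fun j => (abacus ht (0, y.1.1) j).1) y.2
  left_inv f := by
    dsimp only
    rw [abacus_ofRunners ht (sum_abacus_fst ht _)]
    exact ofRunners_abacus ht f
  right_inv := by
    rintro ⟨⟨f, hf⟩, q⟩
    have h := (isCore_iff_abacus ht f).1 hf
    refine Prod.ext (Subtype.ext ?_) ?_
    · dsimp only
      rw [abacus_ofRunners ht (sum_abacus_fst ht _)]
      nth_rw 2 [← ofRunners_abacus ht f]
      exact congrArg _ (funext fun j => (h j).symm)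
    · dsimp only
      rw [abacus_ofRunners ht (sum_abacus_fst ht _)]

theorem size_coreQuotientEquiv {t : ℕ} (ht : 0 < t) (f : RowSeq) :
    (coreQuotientEquiv ht f).1.1.size + t * ∑ j, ((coreQuotientEquiv ht f).2 j).size = f.size := by
  symm
  refine size_eq_of_abacus_fst_eq ht (x := (0, f)) (y := (0, (coreQuotientEquiv ht f).1.1))
    (fun j => ?_) ((isCore_iff_abacus ht _).1 (coreQuotientEquiv ht f).1.2)
  simp only [coreQuotientEquiv, Equiv.coe_fn_mk]
  rw [abacus_ofRunners ht (sum_abacus_fst ht _)]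

end RowSeq

namespace RowSeq

theorem lt_countP_iff {l : List ℕ} (hl : l.Pairwise (· ≥ ·)) (i j : ℕ) :
    i < l.countP (j < ·) ↔ j < l.getD i 0 := by
  induction l generalizing i with
  | nil => simp
  | cons a l ih =>
    rw [List.pairwise_cons] at hl
    by_cases ha : j < a
    · rw [List.countP_cons_of_pos (by simpa using ha)]
      cases i with
      | zero => simp [ha]
      | succ i => simpa using ih hl.2 i
    · have h0 : ∀ b ∈ a :: l, b ≤ j := by
        intro b hb
        rcases List.mem_cons.1 hb with rfl | hb
        · exact not_lt.1 ha
        · exact (hl.1 b hb).trans (not_lt.1 ha)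
      have h1 : (a :: l).countP (j < ·) = 0 :=
        List.countP_eq_zero.2 fun b hb => by simpa using h0 b hb
      rw [h1]
      refine iff_of_false (Nat.not_lt_zero i) (not_lt.2 ?_)
      by_cases hi : i < (a :: l).length
      · rw [List.getD_eq_getElem _ _ hi]
        exact h0 _ (List.getElem_mem hi)
      · rw [List.getD_eq_default _ _ (not_lt.1 hi)]
        exact Nat.zero_le j

/-- The parts of a multiset in weakly decreasing order. -/
abbrev rowList (s : Multiset ℕ) : List ℕ := (s.sort (· ≤ ·)).reverse

theorem coe_rowList (s : Multiset ℕ) : (rowList s : Multiset ℕ) = s := by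
  rw [rowList, Multiset.coe_reverse, Multiset.sort_eq]

theorem pairwise_rowList (s : Multiset ℕ) : (rowList s).Pairwise (· ≥ ·) :=
  List.pairwise_reverse.2 (Multiset.pairwise_sort s _)

theorem rowList_coe {l : List ℕ} (hl : l.Pairwise (· ≥ ·)) : rowList l = l :=
  (Multiset.coe_eq_coe.1 (coe_rowList l)).eq_of_pairwise' (pairwise_rowList _) hl

theorem card_filter_lt (s : Multiset ℕ) (j : ℕ) :
    (s.filter (fun x => j < x)).card = (rowList s).countP (j < ·) := by
  rw [← Multiset.countP_eq_card_filter]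
  conv_lhs => rw [← coe_rowList s]
  rw [Multiset.coe_countP]

/-- The row lengths of a partition. -/
noncomputable def ofPartition (x : Σ n, Nat.Partition n) : RowSeq :=
  ⟨Finsupp.onFinset (Finset.range (rowList x.2.parts).length)
    (fun i => (rowList x.2.parts).getD i 0) fun i hi => by
      by_contra h
      exact hi (List.getD_eq_default _ _ (by simpa using h)),
  fun i j hij => by
    by_contra h
    have h1 := (lt_countP_iff (pairwise_rowList x.2.parts) j _).2 (not_le.1 h)
    exact lt_irrefl _ ((lt_countP_iff (pairwise_rowList x.2.parts) i _).1 (hij.trans_lt h1))⟩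

theorem ofPartition_apply (x : Σ n, Nat.Partition n) (i : ℕ) :
    (ofPartition x).1 i = (rowList x.2.parts).getD i 0 := rfl

theorem size_ofPartition (x : Σ n, Nat.Partition n) : (ofPartition x).size = x.1 := by
  rw [size_eq_sum_range (L := (rowList x.2.parts).length) _ fun i hi =>
    List.getD_eq_default _ _ hi]
  have h : (rowList x.2.parts).sum = x.1 := by
    rw [← Multiset.sum_coe, coe_rowList, x.2.parts_sum]
  refine Eq.trans ?_ h
  rw [← Fin.sum_univ_getElem, Finset.sum_range]
  refine Finset.sum_congr rfl fun i _ => ?_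
  rw [ofPartition_apply, List.getD_eq_getElem _ _ i.2]

theorem ofPartition_injective : Function.Injective ofPartition := by
  intro x y h
  have hlen : ∀ (x : Σ n, Nat.Partition n) i,
      i < (rowList x.2.parts).length ↔ 0 < (ofPartition x).1 i := by
    intro x i
    rw [ofPartition_apply]
    constructor
    · intro hi
      rw [List.getD_eq_getElem _ _ hi]
      refine x.2.parts_pos ?_
      have := Multiset.mem_coe.2 (List.getElem_mem hi)
      rwa [coe_rowList] at this
    · intro hi
      by_contra hc
      rw [List.getD_eq_default _ _ (not_lt.1 hc)] at hi
      exact lt_irrefl _ hi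
  have hl : rowList x.2.parts = rowList y.2.parts := by
    refine List.ext_getElem (eq_of_forall_lt_iff fun i => by rw [hlen, hlen, h]) fun i h1 h2 => ?_
    rw [← List.getD_eq_getElem _ 0 h1, ← List.getD_eq_getElem _ 0 h2, ← ofPartition_apply,
      ← ofPartition_apply, h]
  have hp : x.2.parts = y.2.parts := by
    rw [← coe_rowList x.2.parts, hl, coe_rowList]
  obtain ⟨n, a⟩ := x
  obtain ⟨m, b⟩ := y
  obtain rfl : n = m := by
    rw [← a.parts_sum, ← b.parts_sum]
    exact congrArg _ hp
  exact congrArg _ (Nat.Partition.ext hp)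

theorem ofPartition_surjective : Function.Surjective ofPartition := by
  intro f
  let l : List ℕ := (List.range (f.col 0)).map f.1
  have hl : l.Pairwise (· ≥ ·) := by
    rw [List.pairwise_map]
    exact List.pairwise_lt_range.imp fun h => f.2 h.le
  refine ⟨⟨l.sum, ⟨l, fun {i} hi => ?_, Multiset.sum_coe l⟩⟩, ?_⟩
  · obtain ⟨k, hk, rfl⟩ := List.mem_map.1 (Multiset.mem_coe.1 hi)
    exact (f.lt_col_iff k 0).1 (List.mem_range.1 hk)
  · refine Subtype.ext (Finsupp.ext fun i => ?_)
    rw [ofPartition_apply]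
    dsimp only
    rw [rowList_coe hl]
    by_cases hi : i < f.col 0
    · rw [List.getD_eq_getElem _ _ (by simpa [l] using hi)]
      simp [l]
    · rw [List.getD_eq_default _ _ (by simpa [l] using hi)]
      have := (f.lt_col_iff i 0).2.mt hi
      omega

/-- The bijection between partitions and their sequences of row lengths. -/
noncomputable def partitionEquiv : (Σ n, Nat.Partition n) ≃ RowSeq :=
  Equiv.ofBijective ofPartition ⟨ofPartition_injective, ofPartition_surjective⟩

theorem isCore_ofPartition_iff (t : ℕ) (x : Σ n, Nat.Partition n) :
    IsCore t (ofPartition x) ↔ IsTCore t x.2 := by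
  have hcol : ∀ j, (ofPartition x).col j = (x.2.parts.filter (fun y => j < y)).card := by
    intro j
    refine eq_of_forall_lt_iff fun i => ?_
    rw [lt_col_iff, card_filter_lt, lt_countP_iff (pairwise_rowList _), ofPartition_apply]
  simp only [IsCore, IsTCore, hookLength, hcol, ofPartition_apply]

theorem isGenSeries_size :
    IsGenSeries size (PowerSeries.mk fun n => (Fintype.card n.Partition : ℤ)) := by
  have h : IsGenSeries (fun x : Σ n, Nat.Partition n => x.1)
      (PowerSeries.mk fun n => (Fintype.card n.Partition : ℤ)) := by
    intro n
    let e : {x : Σ n, Nat.Partition n // x.1 = n} ≃ n.Partition := Equiv.sigmaSubtype n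
    exact ⟨Finite.of_equiv _ e.symm, by
      rw [PowerSeries.coeff_mk, Nat.card_congr e, Nat.card_eq_fintype_card]⟩
  exact h.of_equiv partitionEquiv size_ofPartition

theorem numA_eq_card (t k n : ℕ) :
    numA t k n = Nat.card {g : Fin k → {f : RowSeq // IsCore t f} // ∑ i, (g i).1.size = n} := by
  let toRows (x : Σ m : Fin (n + 1), Nat.Partition m) : RowSeq := ofPartition ⟨x.1, x.2⟩
  have hinj : Function.Injective toRows := by
    rintro ⟨⟨a, ha⟩, p⟩ ⟨⟨b, hb⟩, q⟩ h
    have h' := ofPartition_injective h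
    simp only [Sigma.mk.injEq] at h'
    obtain ⟨rfl, h'⟩ := h'
    rw [eq_of_heq h']
  refine Nat.card_eq_of_bijective (fun f => ⟨fun i => ⟨toRows (f.1 i),
    (isCore_ofPartition_iff t _).2 (f.2.2 i)⟩, ?_⟩) ⟨fun f g h => ?_, fun g => ?_⟩
  · simp only [toRows, size_ofPartition]
    exact f.2.1
  · refine Subtype.ext (funext fun i => hinj ?_)
    exact congrArg Subtype.val (congrFun (congrArg Subtype.val h) i)
  · choose x hx using fun i => ofPartition_surjective (g.1 i).1
    have hsize : ∀ i, (x i).1 = (g.1 i).1.size := fun i => by rw [← size_ofPartition, hx]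
    have hle : ∀ i, (x i).1 < n + 1 := fun i => by
      rw [hsize, Nat.lt_succ_iff]
      exact (Finset.single_le_sum (f := fun i => (g.1 i).1.size) (fun _ _ => Nat.zero_le _)
        (Finset.mem_univ i)).trans g.2.le
    refine ⟨⟨fun i => ⟨⟨(x i).1, hle i⟩, (x i).2⟩, ?_, fun i => ?_⟩, ?_⟩
    · simp only [hsize]
      exact g.2
    · exact (isCore_ofPartition_iff t (x i)).1 (hx i ▸ (g.1 i).2)
    · exact Subtype.ext (funext fun i => Subtype.ext (hx i))

/-- The generating series of `t`-cores, up to a series in `X ^ t`, is that of all partitions. -/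
theorem exists_core_series {t : ℕ} (ht : t ≠ 0) :
    ∃ C Q : PowerSeries ℤ, (∀ k n, PowerSeries.coeff n (C ^ k) = numA t k n) ∧
      C * PowerSeries.expand t ht Q = PowerSeries.mk fun n => (Fintype.card n.Partition : ℤ) := by
  have ht' := Nat.pos_of_ne_zero ht
  have hC := isGenSeries_size.subtype (IsCore t)
  refine ⟨PowerSeries.mk fun n => (Nat.card {a : {f : RowSeq // IsCore t f} // a.1.size = n} : ℤ),
    (PowerSeries.mk fun n => (Fintype.card n.Partition : ℤ)) ^ t,
    fun k n => by rw [numA_eq_card, ((hC.pow k) n).2], ?_⟩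
  exact ((hC.prod ((isGenSeries_size.pow t).expand ht)).of_equiv
    (coreQuotientEquiv ht').symm fun y => by
      rw [← size_coreQuotientEquiv ht', Equiv.apply_symm_apply]).eq isGenSeries_size

end RowSeq

theorem stmt_0 (p : ℕ) (hp : p.Prime) (hp5 : 5 ≤ p) (r : ℕ) (hr1 : 1 ≤ r) (hr2 : r ≤ p - 1)
    (hnr : ¬ IsSquare ((24 * r + 1 : ℕ) : ZMod p)) :
    ∀ n i N : ℕ, 1 ≤ i → 1 ≤ N →
      p ^ N ∣ numA p (p ^ N * i - 1) (p * n + r) := by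
  intro n i N hi hN
  obtain ⟨C, Q, hC, hQ⟩ := RowSeq.exists_core_series hp.ne_zero
  have h := prime_pow_dvd_coeff_pow_of_mul_expand_eq hp hnr
    partition_series_mul_pentagonalSeries hQ n hi hN
  rw [hC] at h
  exact_mod_cast h
end

section
/- Let p ≥ 5 be a prime and let r be an integer with 1 ≤ r ≤ p − 1 such that 8r + 1 is a quadratic nonresidue modulo p. Then for all integers n ≥ 0, i ≥ 1 and N ≥ 1, A_{p, p^N i − 3}(p n + r) ≡ 0 (mod p^N). -/
open Finset PowerSeries

/-- The finite `q`-Pochhammer product `(1 - q) ⋯ (1 - q ^ n)`. -/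
def qPoch {R : Type*} [CommRing R] (q : R) (n : ℕ) : R := ∏ j ∈ range n, (1 - q ^ (j + 1))

/-- The Gaussian binomial coefficient. -/
def gauss {R : Type*} [CommRing R] (q : R) : ℕ → ℕ → R
  | _, 0 => 1
  | 0, _ + 1 => 0
  | n + 1, k + 1 => gauss q n k + q ^ (k + 1) * gauss q n (k + 1)

theorem gauss_zero_right {R : Type*} [CommRing R] (q : R) (n : ℕ) : gauss q n 0 = 1 := by
  cases n <;> rfl

theorem gauss_eq_zero {R : Type*} [CommRing R] (q : R) : ∀ {n k : ℕ}, n < k → gauss q n k = 0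
  | 0, 0, h => by omega
  | 0, k + 1, _ => rfl
  | n + 1, 0, h => by omega
  | n + 1, k + 1, h => by
    rw [gauss, gauss_eq_zero q (by omega : n < k), gauss_eq_zero q (by omega : n < k + 1)]
    ring

theorem map_gauss {R S : Type*} [CommRing R] [CommRing S] (φ : R →+* S) (q : R) :
    ∀ n k : ℕ, φ (gauss q n k) = gauss (φ q) n k
  | n, 0 => by simp [gauss_zero_right]
  | 0, k + 1 => by simp [gauss]
  | n + 1, k + 1 => by simp [gauss, map_gauss φ q n]

theorem qPoch_succ {R : Type*} [CommRing R] (q : R) (n : ℕ) :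
    qPoch q (n + 1) = qPoch q n * (1 - q ^ (n + 1)) := prod_range_succ _ _

theorem qPoch_mul_gauss {R : Type*} [CommRing R] (q : R) : ∀ m k : ℕ,
    qPoch q m * qPoch q k * gauss q (m + k) m = qPoch q (m + k)
  | 0, k => by simp [qPoch, gauss_zero_right]
  | m + 1, 0 => by
    have h := qPoch_mul_gauss q m 0
    rw [show m + 1 + 0 = m + 1 from rfl, gauss, gauss_eq_zero q (Nat.lt_succ_self m), qPoch_succ]
    rw [add_zero] at h
    linear_combination (1 - q ^ (m + 1)) * h
  | m + 1, k + 1 => by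
    have h := qPoch_mul_gauss q m (k + 1)
    have h' := qPoch_mul_gauss q (m + 1) k
    rw [show m + 1 + k = m + k + 1 by ring] at h'
    rw [show m + (k + 1) = m + k + 1 by ring] at h
    rw [show m + 1 + (k + 1) = (m + k + 1) + 1 by ring, gauss, qPoch_succ q (m + k + 1)]
    simp only [qPoch_succ q m, qPoch_succ q k] at *
    linear_combination (1 - q ^ (m + 1)) * h + (1 - q ^ (k + 1)) * q ^ (m + 1) * h'
termination_by m k => m + k

theorem prod_add_mul_pow {R : Type*} [CommRing R] (q y : R) (L : ℕ) : ∀ z : R,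
    ∏ j ∈ range L, (y + z * q ^ j) =
      ∑ m ∈ range (L + 1), z ^ m * y ^ (L - m) * q ^ m.choose 2 * gauss q L m := by
  induction L with
  | zero => simp [gauss]
  | succ L ih =>
    intro z
    have h1 : ∏ j ∈ range L, (y + z * q ^ (j + 1)) = ∏ j ∈ range L, (y + z * q * q ^ j) :=
      prod_congr rfl fun j _ => by ring
    rw [prod_range_succ', h1, ih, sum_range_succ' _ (L + 1)]
    have h2 : ∀ m ∈ range (L + 1), z ^ (m + 1) * y ^ (L + 1 - (m + 1)) * q ^ (m + 1).choose 2 *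
        gauss q (L + 1) (m + 1) =
        z * ((z * q) ^ m * y ^ (L - m) * q ^ m.choose 2 * gauss q L m) +
        z ^ (m + 1) * y ^ (L + 1 - (m + 1)) * q ^ (m + 1).choose 2 * q ^ (m + 1) *
          gauss q L (m + 1) := by
      intro m _
      rw [gauss, show (m + 1).choose 2 = m + m.choose 2 by
        rw [Nat.choose_succ_succ' m 1, Nat.choose_one_right], Nat.add_sub_add_right]
      ring
    have h3 : ∀ m ∈ range L, z ^ (m + 1) * y ^ (L + 1 - (m + 1)) * q ^ (m + 1).choose 2 *
        q ^ (m + 1) * gauss q L (m + 1) =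
        y * ((z * q) ^ (m + 1) * y ^ (L - (m + 1)) * q ^ (m + 1).choose 2 * gauss q L (m + 1)) := by
      intro m hm
      rw [show L + 1 - (m + 1) = L - (m + 1) + 1 by have := mem_range.1 hm; omega]
      ring
    have h4 : ∑ m ∈ range (L + 1), z ^ (m + 1) * y ^ (L + 1 - (m + 1)) * q ^ (m + 1).choose 2 *
        q ^ (m + 1) * gauss q L (m + 1) + y * y ^ L =
        y * ∑ m ∈ range (L + 1), (z * q) ^ m * y ^ (L - m) * q ^ m.choose 2 * gauss q L m := by
      rw [sum_range_succ _ L, gauss_eq_zero q (Nat.lt_succ_self L), sum_congr rfl h3, ← mul_sum,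
        sum_range_succ' _ L]
      simp [gauss_zero_right]
      ring
    rw [sum_congr rfl h2, sum_add_distrib, ← mul_sum, mul_add, mul_comm, ← h4]
    simp [gauss_zero_right]
    ring

theorem prod_range_mul_eq {R : Type*} [CommMonoid R] (t L : ℕ) (f : ℕ → R) :
    ∏ j ∈ range (t * L), f j = ∏ c : Fin t, ∏ j ∈ range L, f (t * j + c) := by
  induction L with
  | zero => simp
  | succ L ih =>
    rw [mul_add_one, prod_range_add, ih]
    simp_rw [prod_range_succ, prod_mul_distrib]
    rw [prod_range]

theorem gauss_mul_eq_sum {R : Type*} [CommRing R] (q : R) (t L M : ℕ) :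
    q ^ M.choose 2 * gauss q (t * L) M =
      ∑ m ∈ Fintype.piFinset (fun _ : Fin t => range (L + 1)) with ∑ c, m c = M,
        q ^ (∑ c : Fin t, ((c : ℕ) * m c + t * (m c).choose 2)) *
          ∏ c, gauss (q ^ t) L (m c) := by
  have h := prod_add_mul_pow (Polynomial.C q) 1 (t * L) Polynomial.X
  have h' : ∏ j ∈ range (t * L), (1 + Polynomial.X * Polynomial.C q ^ j) =
      ∑ m ∈ Fintype.piFinset (fun _ : Fin t => range (L + 1)),
        Polynomial.X ^ (∑ c, m c) *
        Polynomial.C (q ^ (∑ c : Fin t, ((c : ℕ) * m c + t * (m c).choose 2)) *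
          ∏ c, gauss (q ^ t) L (m c)) := by
    rw [prod_range_mul_eq]
    have h1 : ∀ c : Fin t, ∏ j ∈ range L, (1 + Polynomial.X * Polynomial.C q ^ (t * j + c)) =
        ∑ m ∈ range (L + 1), Polynomial.X ^ m * Polynomial.C
          (q ^ ((c : ℕ) * m + t * m.choose 2) * gauss (q ^ t) L m) := by
      intro c
      have := prod_add_mul_pow (Polynomial.C q ^ t) 1 L (Polynomial.X * Polynomial.C q ^ (c : ℕ))
      rw [← map_pow Polynomial.C q t] at this
      simp only [← map_gauss] at this
      convert this using 2 with j _ m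
      · rw [map_pow]; ring
      · simp only [map_mul, map_pow]; ring
    simp only [h1]
    rw [prod_univ_sum]
    refine sum_congr rfl fun m _ => ?_
    rw [prod_mul_distrib, prod_pow_eq_pow_sum, ← map_prod, prod_mul_distrib, prod_pow_eq_pow_sum]
  rw [h'] at h
  have h2 := congrArg (fun P => Polynomial.coeff P M) h
  simp only [← map_gauss] at h2
  simp only [Polynomial.finsetSum_coeff, one_pow, mul_one, ← map_pow, mul_assoc, ← map_mul,
    Polynomial.coeff_X_pow_mul', Polynomial.coeff_C] at h2
  rw [sum_filter]
  have key : ∀ a : ℕ, ∀ x : R, (if a ≤ M then if M - a = 0 then x else 0 else 0) =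
     if a = M then x else 0 := by
    intro a x
    split_ifs <;> first | rfl | omega
  simp only [key] at h2
  rw [h2, sum_ite_eq' ]
  split_ifs with hM
  · rfl
  · rw [gauss_eq_zero q (by simpa using hM), mul_zero]

theorem isUnit_qPoch {t : ℕ} (ht : 1 ≤ t) (n : ℕ) : IsUnit (qPoch (X ^ t : ℤ⟦X⟧) n) := by
  rw [PowerSeries.isUnit_iff_constantCoeff, qPoch, map_prod]
  have : t ≠ 0 := by omega
  simp [this]

theorem X_pow_dvd_qPoch_sub {t : ℕ} (ht : 1 ≤ t) (K d : ℕ) :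
    (X : ℤ⟦X⟧) ^ (K + 1) ∣ qPoch (X ^ t) (K + d) - qPoch (X ^ t) K := by
  induction d with
  | zero => simp
  | succ d ih =>
    have h : qPoch (X ^ t : ℤ⟦X⟧) (K + (d + 1)) - qPoch (X ^ t) K =
        (qPoch (X ^ t) (K + d) - qPoch (X ^ t) K) -
          (X ^ t) ^ (K + d + 1) * qPoch (X ^ t) (K + d) := by
      rw [← add_assoc, qPoch_succ]
      ring
    rw [h]
    refine dvd_sub ih (Dvd.dvd.mul_right ?_ _)
    rw [← pow_mul]
    exact pow_dvd_pow _ (by nlinarith)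

theorem X_pow_dvd_qPoch_mul_gauss_sub_one {t K m k : ℕ} (ht : 1 ≤ t) (hm : K ≤ m) (hk : K ≤ k) :
    (X : ℤ⟦X⟧) ^ (K + 1) ∣ qPoch (X ^ t) K * gauss (X ^ t) (m + k) m - 1 := by
  obtain ⟨a, rfl⟩ := Nat.exists_eq_add_of_le hm
  obtain ⟨b, rfl⟩ := Nat.exists_eq_add_of_le hk
  obtain ⟨u, hu⟩ := X_pow_dvd_qPoch_sub ht K a
  obtain ⟨v, hv⟩ := X_pow_dvd_qPoch_sub ht K b
  obtain ⟨w, hw⟩ := X_pow_dvd_qPoch_sub ht K (a + (K + b))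
  rw [← (isUnit_qPoch ht K).dvd_mul_left]
  have h := qPoch_mul_gauss (X ^ t : ℤ⟦X⟧) (K + a) (K + b)
  rw [← add_assoc] at hw
  generalize gauss (X ^ t : ℤ⟦X⟧) (K + a + (K + b)) (K + a) = g at *
  rw [sub_eq_iff_eq_add] at hu hv hw
  rw [hu, hv, hw] at h
  generalize qPoch (X ^ t : ℤ⟦X⟧) K = P at *
  refine ⟨w - u * (X ^ (K + 1) * v + P) * g - P * v * g, ?_⟩
  linear_combination h

/-- The exponents in Jacobi's expansion, recentred at `s`. -/
def recentredTriangle (s m : ℕ) : ℕ := if s < m then (m - s).choose 2 else (s - m + 1).choose 2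

theorem two_mul_choose_two (n : ℕ) : 2 * (n + 1).choose 2 = (n + 1) * n := by
  rw [Nat.choose_two_right, Nat.add_sub_cancel, Nat.mul_div_cancel']
  exact (Nat.even_mul_succ_self n).two_dvd.trans (dvd_of_eq (mul_comm _ _))

theorem recentredTriangle_spec {s m : ℕ} (hm : m ≤ 2 * s + 1) :
    s * (2 * s + 1 - m) + m.choose 2 = (s + s.choose 2 + s * s) + recentredTriangle s m := by
  rw [recentredTriangle]
  have hs : 2 * s.choose 2 + s = s * s := by
    rcases s with _ | s
    · rfl
    · rw [two_mul_choose_two]; ring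
  split_ifs with h
  · obtain ⟨a, rfl⟩ := Nat.exists_eq_add_of_le (Nat.succ_le_of_lt h)
    obtain ⟨b, rfl⟩ := Nat.exists_eq_add_of_le (by omega : a ≤ s)
    have h1 := two_mul_choose_two (a + b + a)
    have h2 := two_mul_choose_two a
    rw [show 2 * (a + b) + 1 - ((a + b).succ + a) = b by omega,
      show (a + b).succ + a = a + b + a + 1 by omega,
      show a + b + a + 1 - (a + b) = a + 1 by omega]
    nlinarith
  · obtain ⟨a, rfl⟩ := Nat.exists_eq_add_of_le (not_lt.1 h)
    have h2 := two_mul_choose_two a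
    rw [show 2 * (m + a) + 1 - m = m + 2 * a + 1 by omega, show m + a - m + 1 = a + 1 by omega]
    have h1 : 2 * m.choose 2 + m = m * m := by
      rcases m with _ | s
      · rfl
      · rw [two_mul_choose_two]; ring
    nlinarith

theorem exists_recentredTriangle (s m : ℕ) : ∃ a, recentredTriangle s m = (a + 1).choose 2 := by
  rw [recentredTriangle]
  split_ifs with h
  · exact ⟨m - s - 1, by congr 1; omega⟩
  · exact ⟨_, rfl⟩

theorem le_recentredTriangle {s m K : ℕ} (h : m + K < s ∨ s + 1 + K < m) :
    K + 1 ≤ recentredTriangle s m := by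
  rw [recentredTriangle]
  have key : ∀ a, K + 1 ≤ a → K + 1 ≤ (a + 1).choose 2 := fun a ha => by
    have := two_mul_choose_two a
    nlinarith
  split_ifs with h'
  · rw [show m - s = m - s - 1 + 1 by omega]
    exact key _ (by omega)
  · exact key _ (by omega)

theorem prod_pow_sub_pow_left {R : Type*} [CommRing R] (q : R) (s : ℕ) :
    ∏ j ∈ range s, (q ^ s - q ^ j) = (-1) ^ s * q ^ s.choose 2 * qPoch q s := by
  have h : ∀ j ∈ range s, q ^ s - q ^ j = (-1) * q ^ j * (1 - q ^ (s - 1 - j + 1)) := by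
    intro j hj
    have := mem_range.1 hj
    have h2 : q ^ s = q ^ j * q ^ (s - 1 - j + 1) := by
      rw [← pow_add]; congr 1; omega
    rw [h2]; ring
  rw [prod_congr rfl h, prod_mul_distrib, prod_mul_distrib, prod_const, card_range,
    prod_pow_eq_pow_sum, sum_range_id, ← Nat.choose_two_right,
    prod_range_reflect (fun j => 1 - q ^ (j + 1)) s, qPoch]

theorem qPoch_sq_eq_sum (s : ℕ) :
    (-1) ^ s * qPoch (X : ℤ⟦X⟧) s ^ 2 = ∑ m ∈ range (2 * s + 2),
      (-1) ^ (m - 1) * (m : ℤ⟦X⟧) * (X ^ recentredTriangle s m * gauss X (2 * s + 1) m) := by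
  have h := prod_add_mul_pow (Polynomial.C (X : ℤ⟦X⟧)) (Polynomial.C X ^ s) (2 * s + 1)
    Polynomial.X
  rw [show 2 * s + 1 = s + 1 + s by ring, prod_range_add, prod_range_succ] at h
  have h1 := congrArg (fun P => Polynomial.eval (-1) (Polynomial.derivative P)) h
  simp only [← map_gauss, ← map_pow, ← pow_mul] at h1
  simp only [Polynomial.derivative_mul, Polynomial.derivative_sum, Polynomial.derivative_add,
    Polynomial.derivative_C, Polynomial.derivative_X, Polynomial.eval_add, Polynomial.eval_mul,
    Polynomial.eval_C, Polynomial.eval_X, Polynomial.eval_finsetSum, Polynomial.derivative_X_pow,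
    Polynomial.eval_prod, Polynomial.eval_pow, mul_zero, add_zero, zero_add, one_mul] at h1
  have h2 : ∏ j ∈ range s, (X ^ s + -1 * X ^ j : ℤ⟦X⟧) =
      (-1) ^ s * X ^ s.choose 2 * qPoch X s := by
    rw [← prod_pow_sub_pow_left]
    exact prod_congr rfl fun j _ => by ring
  have h3 : ∏ j ∈ range s, (X ^ s + -1 * X ^ (s + 1 + j) : ℤ⟦X⟧) = X ^ (s * s) * qPoch X s := by
    have e : (X : ℤ⟦X⟧) ^ (s * s) = ∏ _j ∈ range s, X ^ s := by simp [pow_mul]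
    rw [qPoch, e, ← prod_mul_distrib]
    exact prod_congr rfl fun j _ => by ring
  rw [h2, h3] at h1
  refine mul_left_cancel₀ (pow_ne_zero (s + s.choose 2 + s * s) X_ne_zero) ?_
  rw [mul_sum]
  trans ((-1) ^ s * X ^ s.choose 2 * qPoch X s * X ^ s * (X ^ (s * s) * qPoch X s) : ℤ⟦X⟧)
  · ring
  convert h1 using 1
  · ring
  · rw [show 2 * s + 2 = s + 1 + s + 1 by ring]
    refine sum_congr rfl fun m hm => ?_
    have hm' : m ≤ 2 * s + 1 := by have := mem_range.1 hm; omega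
    rw [mul_left_comm, ← mul_assoc (X ^ _), ← pow_add, ← recentredTriangle_spec hm',
      show s + 1 + s = 2 * s + 1 by ring]
    ring

theorem coeff_qPoch_pow_three {K n : ℕ} (hn : n ≤ K) (h : ∀ a : ℕ, n ≠ (a + 1).choose 2) :
    coeff n (qPoch (X : ℤ⟦X⟧) K ^ 3) = 0 := by
  set s := 2 * K with hs
  have h1 : (X : ℤ⟦X⟧) ^ (K + 1) ∣ (-1) ^ s * qPoch (X : ℤ⟦X⟧) K ^ 3 -
      ∑ m ∈ range (2 * s + 2), (-1) ^ (m - 1) * (m : ℤ⟦X⟧) * X ^ recentredTriangle s m := by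
    obtain ⟨u, hu⟩ := X_pow_dvd_qPoch_sub le_rfl K K
    rw [pow_one, ← two_mul, ← hs, sub_eq_iff_eq_add] at hu
    have h2 := qPoch_sq_eq_sum s
    rw [hu] at h2
    have h3 : (-1) ^ s * qPoch (X : ℤ⟦X⟧) K ^ 3 -
        ∑ m ∈ range (2 * s + 2), (-1) ^ (m - 1) * (m : ℤ⟦X⟧) * X ^ recentredTriangle s m =
        (∑ m ∈ range (2 * s + 2), (-1) ^ (m - 1) * (m : ℤ⟦X⟧) * (X ^ recentredTriangle s m *
          (qPoch X K * gauss X (2 * s + 1) m - 1))) - X ^ (K + 1) *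
          ((-1) ^ s * qPoch X K * u * (X ^ (K + 1) * u + 2 * qPoch X K)) := by
      have h4 : ∑ m ∈ range (2 * s + 2), (-1) ^ (m - 1) * (m : ℤ⟦X⟧) * (X ^ recentredTriangle s m *
          (qPoch X K * gauss X (2 * s + 1) m - 1)) = qPoch X K *
          (∑ m ∈ range (2 * s + 2), (-1) ^ (m - 1) * (m : ℤ⟦X⟧) * (X ^ recentredTriangle s m *
          gauss X (2 * s + 1) m)) -
          ∑ m ∈ range (2 * s + 2), (-1) ^ (m - 1) * (m : ℤ⟦X⟧) * X ^ recentredTriangle s m := by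
        rw [mul_sum, ← sum_sub_distrib]
        exact sum_congr rfl fun m _ => by ring
      rw [h4, ← h2]
      ring
    rw [h3]
    refine dvd_sub (dvd_sum fun m hm => Dvd.dvd.mul_left ?_ _) (dvd_mul_right _ _)
    have hm' := mem_range.1 hm
    by_cases hb : m + K < s ∨ s + 1 + K < m
    · exact Dvd.dvd.mul_right (pow_dvd_pow _ (le_recentredTriangle hb)) _
    · push Not at hb
      have := X_pow_dvd_qPoch_mul_gauss_sub_one (t := 1) (K := K) (m := m) (k := 2 * s + 1 - m)
        le_rfl (by omega) (by omega)
      rw [pow_one, show m + (2 * s + 1 - m) = 2 * s + 1 by omega] at this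
      exact Dvd.dvd.mul_left this _
  rw [X_pow_dvd_iff] at h1
  have h2 := h1 n (by omega)
  rw [map_sub, map_sum, sum_eq_zero, sub_zero] at h2
  · rcases neg_one_pow_eq_or ℤ⟦X⟧ s with h3 | h3 <;> simpa [h3] using h2
  · intro m _
    obtain ⟨a, ha⟩ := exists_recentredTriangle s m
    have h3 : ((-1) ^ (m - 1) * (m : ℤ⟦X⟧)) = C ((-1) ^ (m - 1) * (m : ℤ)) := by simp
    rw [h3, coeff_C_mul, coeff_X_pow, if_neg (by rw [ha]; exact h a), mul_zero]

/-- The `i`-th largest part of a partition, or `0` if there are at most `i` parts. -/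
def partitionRow {n : ℕ} (p : n.Partition) (i : ℕ) : ℕ :=
  (p.parts.sort (· ≤ ·)).reverse.getD i 0

theorem partitionRow_antitone {n : ℕ} (p : n.Partition) : Antitone (partitionRow p) := by
  have h : ((p.parts.sort (· ≤ ·)).reverse).Pairwise (· ≥ ·) := by
    rw [List.pairwise_reverse]
    exact Multiset.pairwise_sort _ _
  intro i j hij
  rw [partitionRow, partitionRow]
  rcases hij.eq_or_lt with rfl | hij
  · rfl
  by_cases hj : j < (p.parts.sort (· ≤ ·)).reverse.length
  · rw [List.getD_eq_getElem _ _ hj, List.getD_eq_getElem _ _ (hij.trans hj)]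
    exact List.pairwise_iff_getElem.1 h i j _ hj hij
  · rw [List.getD_eq_default _ _ (not_lt.1 hj)]
    exact Nat.zero_le _

theorem card_parts_le {n : ℕ} (p : n.Partition) : p.parts.card ≤ n := by
  have := Multiset.card_nsmul_le_sum (s := p.parts) (a := 1) fun x hx => p.parts_pos hx
  simpa [p.parts_sum] using this

theorem partitionRow_eq_zero {n M : ℕ} (p : n.Partition) (h : p.parts.card ≤ M) (i : ℕ)
    (hi : M ≤ i) : partitionRow p i = 0 :=
  List.getD_eq_default _ _ (by simpa using h.trans hi)

theorem map_partitionRow {n M : ℕ} (p : n.Partition) (h : p.parts.card ≤ M) :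
    (Multiset.range M).map (partitionRow p) = p.parts + Multiset.replicate (M - p.parts.card) 0 := by
  have h1 : (List.range M).map (partitionRow p) =
      (p.parts.sort (· ≤ ·)).reverse ++ List.replicate (M - p.parts.card) 0 := by
    apply List.ext_getElem
    · simp; omega
    · intro i h1 h2
      simp only [List.getElem_map, List.getElem_range, partitionRow, List.getD_eq_getElem?_getD,
        List.getElem_append]
      split_ifs with h3
      · rw [List.getElem?_eq_getElem h3]; rfl
      · rw [List.getElem?_eq_none (not_lt.1 h3)]; simp
  have h2 := congrArg (fun l : List ℕ => (l : Multiset ℕ)) h1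
  simp only [← Multiset.coe_add, Multiset.coe_reverse, Multiset.sort_eq,
    Multiset.coe_replicate] at h2
  rw [← h2]
  rfl

theorem sum_partitionRow {n M : ℕ} (p : n.Partition) (h : p.parts.card ≤ M) :
    ∑ i ∈ range M, partitionRow p i = n := by
  have := congrArg Multiset.sum (map_partitionRow p h)
  rw [Multiset.sum_add, p.parts_sum, Multiset.sum_replicate, smul_zero, add_zero] at this
  exact this

theorem card_filter_partitionRow {n M : ℕ} (p : n.Partition) (h : p.parts.card ≤ M) (j : ℕ) :
    (p.parts.filter (fun x => j < x)).card = #{i ∈ range M | j < partitionRow p i} := by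
  have := congrArg (fun s => (s.filter (fun x => j < x)).card) (map_partitionRow p h)
  simp only [Multiset.filter_map, Multiset.card_map, Multiset.filter_add, Multiset.card_add] at this
  rw [Multiset.filter_eq_nil (s := Multiset.replicate _ _) |>.2
    (fun a ha => by simp [Multiset.eq_of_mem_replicate ha]), Multiset.card_zero, add_zero] at this
  rw [← this]
  rfl

theorem parts_eq_filter {n M : ℕ} (p : n.Partition) (h : p.parts.card ≤ M) :
    p.parts = ((Multiset.range M).map (partitionRow p)).filter (· ≠ 0) := by
  rw [map_partitionRow p h, Multiset.filter_add, Multiset.filter_eq_self.2,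
    Multiset.filter_eq_nil.2, add_zero]
  · intro a ha; simp [Multiset.eq_of_mem_replicate ha]
  · intro a ha; exact (p.parts_pos ha).ne'

theorem eq_range_card {s : Finset ℕ} (h : ∀ a ∈ s, ∀ b < a, b ∈ s) : s = range #s := by
  refine eq_of_subset_of_card_le (fun a ha => ?_) (by simp)
  have : range (a + 1) ⊆ s := fun b hb => by
    rcases (Nat.lt_succ_iff.1 (mem_range.1 hb)).eq_or_lt with rfl | hb
    · exact ha
    · exact h a ha b hb
  simpa using card_le_card this

theorem lt_apply_iff {f : ℕ → ℕ} {M : ℕ} (hf : Antitone f) (h0 : ∀ i, M ≤ i → f i = 0)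
    (i j : ℕ) : j < f i ↔ i < #{x ∈ range M | j < f x} := by
  have h := eq_range_card (s := {x ∈ range M | j < f x}) (fun a ha b hb => by
    simp only [mem_filter, mem_range] at *
    exact ⟨hb.trans ha.1, ha.2.trans_le (hf hb.le)⟩)
  have hi := Finset.ext_iff.1 h i
  rw [mem_filter, mem_range, mem_range] at hi
  rw [← hi]
  refine ⟨fun hj => ⟨?_, hj⟩, fun hj => hj.2⟩
  by_contra hi
  rw [h0 i (not_lt.1 hi)] at hj
  omega

theorem exists_partition {f : ℕ → ℕ} {M n : ℕ} (hf : Antitone f) (h0 : ∀ i, M ≤ i → f i = 0)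
    (hn : ∑ i ∈ range M, f i = n) : ∃ p : n.Partition, p.parts.card ≤ M ∧ partitionRow p = f := by
  have hn' : ((Multiset.range M).map f).sum = n := hn
  let p := Nat.Partition.ofSums n ((Multiset.range M).map f) hn'
  have hp : p.parts.card ≤ M := by
    rw [Nat.Partition.ofSums_parts]
    exact (Multiset.card_le_card (Multiset.filter_le _ _)).trans (by simp)
  refine ⟨p, hp, funext fun i => ?_⟩
  refine eq_of_forall_lt_iff fun j => ?_
  rw [lt_apply_iff hf h0, lt_apply_iff (partitionRow_antitone p) (partitionRow_eq_zero p hp),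
    ← card_filter_partitionRow p hp]
  have : (p.parts.filter (fun x => j < x)).card = #{x ∈ range M | j < f x} := by
    simp only [p, Nat.Partition.ofSums_parts, Multiset.filter_filter]
    rw [Multiset.filter_congr (q := fun x => j < x) (fun x _ => by omega), Multiset.filter_map,
      Multiset.card_map]
    rfl
  rw [this]

/-- The set of first-column hook lengths of a partition with rows `f`, padded to `M` rows. -/
def betaSet (M : ℕ) (f : ℕ → ℕ) : Finset ℕ := (range M).image fun i => f i + (M - 1 - i)

theorem mem_betaSet {M : ℕ} {f : ℕ → ℕ} {a : ℕ} :
    a ∈ betaSet M f ↔ ∃ i < M, f i + (M - 1 - i) = a := by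
  simp [betaSet]

theorem injOn_betaSet {M : ℕ} {f : ℕ → ℕ} (hf : Antitone f) :
    Set.InjOn (fun i => f i + (M - 1 - i)) (range M) := by
  intro i hi j hj h
  simp only [coe_range, Set.mem_Iio] at *
  rcases lt_trichotomy i j with hij | hij | hij
  · have := hf hij.le
    omega
  · exact hij
  · have := hf hij.le
    omega

theorem card_betaSet {M : ℕ} {f : ℕ → ℕ} (hf : Antitone f) : #(betaSet M f) = M := by
  rw [betaSet, card_image_of_injOn (injOn_betaSet hf), card_range]

theorem sum_betaSet {M : ℕ} {f : ℕ → ℕ} (hf : Antitone f) :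
    ∑ x ∈ betaSet M f, x = M.choose 2 + ∑ i ∈ range M, f i := by
  rw [betaSet, sum_image (injOn_betaSet hf), sum_add_distrib, sum_range_reflect (fun i => i) M,
    sum_range_id, Nat.choose_two_right, add_comm]

theorem betaSet_succ (M : ℕ) (f : ℕ → ℕ) :
    betaSet (M + 1) f = insert (f 0 + M) (betaSet M fun i => f (i + 1)) := by
  ext a
  simp only [mem_insert, mem_betaSet]
  constructor
  · rintro ⟨_ | i, hi, rfl⟩
    · left; simp
    · right; exact ⟨i, by omega, by omega⟩
  · rintro (rfl | ⟨i, hi, rfl⟩)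
    · exact ⟨0, by omega, by simp⟩
    · exact ⟨i + 1, by omega, by omega⟩

theorem exists_betaSet_eq (M : ℕ) : ∀ s : Finset ℕ, #s = M →
    ∃ f : ℕ → ℕ, Antitone f ∧ (∀ i, M ≤ i → f i = 0) ∧ betaSet M f = s := by
  induction M with
  | zero =>
    intro s hs
    exact ⟨fun _ => 0, antitone_const, fun _ _ => rfl, by simp [card_eq_zero.1 hs, betaSet]⟩
  | succ M ih =>
    intro s hs
    have hne : s.Nonempty := card_pos.1 (by omega)
    obtain ⟨f, hf, h0, hfs⟩ := ih (s.erase (s.max' hne)) (by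
      rw [card_erase_of_mem (max'_mem _ _), hs, Nat.add_sub_cancel])
    have hM : M ≤ s.max' hne := by
      have : s ⊆ range (s.max' hne + 1) := fun a ha =>
        mem_range.2 (Nat.lt_succ_of_le (le_max' s a ha))
      have := card_le_card this
      rw [card_range] at this
      omega
    refine ⟨fun i => Nat.casesOn i (s.max' hne - M) f, ?_, ?_, ?_⟩
    · refine antitone_nat_of_succ_le ?_
      rintro (_ | i)
      · change f 0 ≤ s.max' hne - M
        rcases Nat.eq_zero_or_pos M with rfl | hM0
        · rw [h0 0 le_rfl]; exact Nat.zero_le _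
        · have h1 : f 0 + (M - 1 - 0) ∈ s.erase (s.max' hne) := by
            rw [← hfs]; exact mem_betaSet.2 ⟨0, hM0, rfl⟩
          have h2 := le_max' s _ (mem_of_mem_erase h1)
          have h3 := ne_of_mem_erase h1
          omega
      · exact hf (Nat.le_succ i)
    · rintro (_ | i) hi
      · omega
      · exact h0 i (by omega)
    · rw [betaSet_succ]
      change insert (s.max' hne - M + M) (betaSet M f) = s
      rw [hfs, Nat.sub_add_cancel hM, insert_erase (max'_mem _ _)]

theorem betaSet_injective (M : ℕ) : ∀ f g : ℕ → ℕ, Antitone f → Antitone g →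
    betaSet M f = betaSet M g → ∀ i < M, f i = g i := by
  induction M with
  | zero => intro f g _ _ _ i hi; omega
  | succ M ih =>
    intro f g hf hg h i hi
    have key : ∀ f : ℕ → ℕ, Antitone f → ∀ a ∈ betaSet (M + 1) f, a ≤ f 0 + M := by
      intro f hf a ha
      obtain ⟨i, hi, rfl⟩ := mem_betaSet.1 ha
      have := hf (Nat.zero_le i)
      omega
    have key' : ∀ f : ℕ → ℕ, Antitone f → f 0 + M ∉ betaSet M fun i => f (i + 1) := by
      intro f hf h
      obtain ⟨i, hi, h⟩ := mem_betaSet.1 h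
      have := hf (Nat.zero_le (i + 1))
      omega
    have h1 := key f hf (g 0 + M) (by rw [h, betaSet_succ]; exact mem_insert_self _ _)
    have h2 := key g hg (f 0 + M) (by rw [← h, betaSet_succ]; exact mem_insert_self _ _)
    have h3 : f 0 = g 0 := by omega
    rcases i with _ | i
    · exact h3
    · refine ih (fun i => f (i + 1)) (fun i => g (i + 1)) (fun a b hab => hf (by omega))
        (fun a b hab => hg (by omega)) ?_ i (by omega)
      rw [betaSet_succ, betaSet_succ] at h
      have h4 := congrArg (fun s => s.erase (f 0 + M)) h
      rw [erase_insert (key' f hf), h3, erase_insert (key' g hg)] at h4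
      exact h4

theorem choose_two_le_sum (s : Finset ℕ) : (#s).choose 2 ≤ ∑ x ∈ s, x := by
  obtain ⟨f, hf, -, hs⟩ := exists_betaSet_eq _ s rfl
  rw [← hs, sum_betaSet hf, card_betaSet hf]
  omega

/-- A set of beads is `t`-flush if every bead can only be slid down by `t` onto another bead. -/
def IsFlush (t : ℕ) (s : Finset ℕ) : Prop := ∀ a ∈ s, t ≤ a → a - t ∈ s

theorem IsFlush.sub_mul_mem {t : ℕ} {s : Finset ℕ} (h : IsFlush t s) {a : ℕ} (ha : a ∈ s)
    (k : ℕ) (hk : t * k ≤ a) : a - t * k ∈ s := by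
  induction k with
  | zero => simpa using ha
  | succ k ih =>
    rw [mul_add_one] at hk ⊢
    rw [← Nat.sub_sub]
    exact h _ (ih (by omega)) (by omega)

theorem isFlush_betaSet_iff {f : ℕ → ℕ} {M t : ℕ} (ht : 1 ≤ t) (hf : Antitone f)
    (h0 : ∀ i, M ≤ i → f i = 0) : IsFlush t (betaSet M f) ↔
      ∀ i j : ℕ, j < f i → ¬ t ∣ (f i - j) + (#{x ∈ range M | j < f x} - i) - 1 := by
  constructor
  · intro h i j hj ⟨k, hk⟩
    set e := #{x ∈ range M | j < f x} with he
    have hie : i < e := (lt_apply_iff hf h0 i j).1 hj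
    have heM : e ≤ M := (card_filter_le _ _).trans (by simp)
    have h1 := h.sub_mul_mem (mem_betaSet.2 ⟨i, by omega, rfl⟩) k (by omega)
    obtain ⟨x, hx, hx'⟩ := mem_betaSet.1 h1
    by_cases hxe : x < e
    · have := (lt_apply_iff hf h0 x j).2 hxe
      omega
    · have := mt (lt_apply_iff hf h0 x j).1 hxe
      omega
  · intro h a ha hta
    by_contra hb
    obtain ⟨i, hi, hia⟩ := mem_betaSet.1 ha
    have hex : ∃ e, M ≤ e ∨ f e + (M - 1 - e) < a - t := ⟨M, Or.inl le_rfl⟩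
    obtain ⟨e, hspec, hmin⟩ : ∃ e, (M ≤ e ∨ f e + (M - 1 - e) < a - t) ∧
        ∀ x < e, ¬ (M ≤ x ∨ f x + (M - 1 - x) < a - t) :=
      ⟨Nat.find hex, Nat.find_spec hex, fun x hx => Nat.find_min hex hx⟩
    have heM : e ≤ M := not_lt.1 fun h1 => hmin M h1 (Or.inl le_rfl)
    have hlt : ∀ x < e, a - t < f x + (M - 1 - x) := by
      intro x hx
      have h1 := hmin x hx
      push Not at h1
      refine lt_of_le_of_ne h1.2 fun h2 => hb ?_
      exact mem_betaSet.2 ⟨x, h1.1, h2.symm⟩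
    have hge : ∀ x, e ≤ x → x < M → f x + (M - 1 - x) < a - t := by
      intro x hx hxM
      rcases hspec with h1 | h1
      · omega
      · have := hf hx
        omega
    have hMe : M ≤ a - t + e := by
      rcases hspec with h1 | h1 <;> omega
    have hiff : ∀ x, a - t + e - M < f x ↔ x < e := by
      intro x
      constructor
      · intro hx
        by_contra hxe
        have h2 : x < M := by
          by_contra hxM
          rw [h0 x (not_lt.1 hxM)] at hx
          omega
        rcases hspec with h1 | h1
        · omega
        · have := hf (not_lt.1 hxe)
          omega
      · intro hx
        have h1 := hlt (e - 1) (by omega)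
        have h2 := hf (show x ≤ e - 1 by omega)
        omega
    have hcard : #{x ∈ range M | a - t + e - M < f x} = e := by
      have : {x ∈ range M | a - t + e - M < f x} = range e := by
        ext x
        simp only [mem_filter, mem_range, hiff]
        omega
      rw [this, card_range]
    have hie : i < e := by
      by_contra hie
      have := hge i (not_lt.1 hie) hi
      omega
    refine h i (a - t + e - M) ((hiff i).2 hie) ?_
    rw [hcard]
    have := (hiff i).2 hie
    have h3 : f i - (a - t + e - M) + (e - i) - 1 = t := by omega
    rw [h3]

theorem isTCore_iff {n M t : ℕ} (ht : 1 ≤ t) (p : n.Partition) (h : p.parts.card ≤ M) :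
    IsTCore t p ↔ IsFlush t (betaSet M (partitionRow p)) := by
  rw [isFlush_betaSet_iff ht (partitionRow_antitone p) (partitionRow_eq_zero p h)]
  simp only [IsTCore, hookLength, card_filter_partitionRow p h]
  rfl

/-- The `t`-flush set with `m c` beads on the runner `c`. -/
def beads {t : ℕ} (m : Fin t → ℕ) : Finset ℕ :=
  (univ.sigma fun c => range (m c)).image fun x => t * x.2 + x.1

theorem mem_beads {t : ℕ} {m : Fin t → ℕ} {x : ℕ} :
    x ∈ beads m ↔ ∃ c : Fin t, ∃ j < m c, t * j + c = x := by
  simp [beads]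

theorem mul_add_fin_inj {t : ℕ} {c d : Fin t} {i j : ℕ} (h : t * i + c = t * j + d) :
    c = d ∧ i = j := by
  have hc := c.2
  have hd := d.2
  have h1 : i = j := by
    have := congrArg (· / t) h
    simpa [Nat.mul_add_div (show 0 < t by omega), Nat.div_eq_of_lt hc, Nat.div_eq_of_lt hd]
      using this
  subst h1
  exact ⟨Fin.ext (by omega), rfl⟩

theorem mul_add_mem_beads {t : ℕ} {m : Fin t → ℕ} {c : Fin t} {j : ℕ} :
    t * j + c ∈ beads m ↔ j < m c := by
  rw [mem_beads]
  constructor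
  · rintro ⟨d, i, hi, h⟩
    obtain ⟨rfl, rfl⟩ := mul_add_fin_inj h
    exact hi
  · exact fun h => ⟨c, j, h, rfl⟩

theorem beads_injective (t : ℕ) : Function.Injective (beads (t := t)) := by
  intro m m' h
  funext c
  refine eq_of_forall_lt_iff fun j => ?_
  rw [← mul_add_mem_beads, h, mul_add_mem_beads]

theorem injOn_beads {t : ℕ} (s : Set (Σ _ : Fin t, ℕ)) :
    Set.InjOn (fun x : Σ _ : Fin t, ℕ => t * x.2 + x.1) s := by
  rintro ⟨c, i⟩ _ ⟨d, j⟩ _ h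
  obtain ⟨rfl, rfl⟩ := mul_add_fin_inj h
  rfl

theorem card_beads {t : ℕ} (m : Fin t → ℕ) : #(beads m) = ∑ c, m c := by
  rw [beads, card_image_of_injOn (injOn_beads _), card_sigma]
  simp

theorem sum_beads {t : ℕ} (m : Fin t → ℕ) :
    ∑ x ∈ beads m, x = ∑ c : Fin t, ((c : ℕ) * m c + t * (m c).choose 2) := by
  rw [beads, sum_image (injOn_beads _), sum_sigma]
  refine sum_congr rfl fun c _ => ?_
  change ∑ j ∈ range (m c), (t * j + (c : ℕ)) = _
  rw [sum_add_distrib, ← mul_sum, sum_range_id, Nat.choose_two_right, sum_const, card_range,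
    smul_eq_mul]
  ring

theorem isFlush_beads {t : ℕ} (m : Fin t → ℕ) : IsFlush t (beads m) := by
  intro a ha hta
  obtain ⟨c, j, hj, rfl⟩ := mem_beads.1 ha
  have := c.2
  obtain ⟨i, rfl⟩ : ∃ i, j = i + 1 := Nat.exists_eq_succ_of_ne_zero (by rintro rfl; omega)
  rw [show t * (i + 1) + c - t = t * i + c by rw [mul_add_one]; omega, mul_add_mem_beads]
  omega

theorem exists_beads_eq {t : ℕ} (ht : 1 ≤ t) {s : Finset ℕ} (h : IsFlush t s) :
    ∃ m : Fin t → ℕ, beads m = s := by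
  obtain ⟨B, hB⟩ := s.exists_nat_subset_range
  have key : ∀ (c : Fin t) (j : ℕ), t * j + c ∈ s ↔ j < #{j ∈ range B | t * j + c ∈ s} := by
    intro c j
    have h1 := eq_range_card (s := {j ∈ range B | t * j + c ∈ s}) (fun a ha b hb => by
      simp only [mem_filter, mem_range] at *
      refine ⟨by omega, ?_⟩
      have h2 : t * (a - b) + t * b = t * a := by rw [← mul_add]; congr 1; omega
      have := h.sub_mul_mem ha.2 (a - b) (by omega)
      rwa [show t * a + c - t * (a - b) = t * b + c by omega] at this)
    have h2 := Finset.ext_iff.1 h1 j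
    rw [mem_filter, mem_range, mem_range] at h2
    rw [← h2]
    refine ⟨fun hj => ⟨?_, hj⟩, fun hj => hj.2⟩
    have := mem_range.1 (hB hj)
    nlinarith
  refine ⟨fun c => #{j ∈ range B | t * j + c ∈ s}, ?_⟩
  ext x
  have hx : t * (x / t) + (⟨x % t, Nat.mod_lt x ht⟩ : Fin t) = x := Nat.div_add_mod x t
  rw [← hx, mul_add_mem_beads, key]

theorem balanced_of_sum_le {t a K : ℕ} (ha : 2 * K ≤ a) {m : Fin t → ℕ}
    (hm : ∑ c, m c = t * a)
    (hw : ∑ c : Fin t, ((c : ℕ) * m c + t * (m c).choose 2) ≤ (t * a).choose 2 + K) (c : Fin t) :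
    K ≤ m c ∧ m c + K ≤ 2 * a := by
  rw [← sum_beads] at hw
  rw [← card_beads] at hm
  have hc := c.2
  constructor
  · by_contra! h
    have h1 : t * m c + c ∉ beads m := by rw [mul_add_mem_beads]; omega
    have h2 := choose_two_le_sum (insert (t * m c + c) (beads m))
    rw [sum_insert h1, card_insert_of_notMem h1, hm, Nat.choose_succ_succ' (t * a) 1,
      Nat.choose_one_right] at h2
    have h3 : t * (m c + 1) ≤ t * K := Nat.mul_le_mul_left t (by omega)
    have h4 : t * (2 * K) ≤ t * a := Nat.mul_le_mul_left t ha
    nlinarith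
  · by_contra! h
    have h1 : t * (m c - 1) + c ∈ beads m := by rw [mul_add_mem_beads]; omega
    have h2 := choose_two_le_sum ((beads m).erase (t * (m c - 1) + c))
    have h3 := add_sum_erase (beads m) (fun x => x) h1
    obtain ⟨M, hM⟩ : ∃ M, t * a = M + 1 :=
      Nat.exists_eq_succ_of_ne_zero (by rw [← hm]; exact (card_pos.2 ⟨_, h1⟩).ne')
    rw [card_erase_of_mem h1, hm, hM, Nat.add_sub_cancel] at h2
    have h6 : (M + 1).choose 2 = M + M.choose 2 := by
      rw [Nat.choose_succ_succ' M 1, Nat.choose_one_right]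
    rw [hM, h6] at hw
    have h4 : t * (a + K) ≤ t * (m c - 1) := Nat.mul_le_mul_left t (by omega)
    have h5 : 1 * K ≤ t * K := Nat.mul_le_mul_right K (by omega)
    rw [mul_add] at h4
    omega

open Classical in
/-- The `t`-core partitions of size at most `K`. -/
noncomputable def coreSet (t K : ℕ) : Finset (Σ m : Fin (K + 1), Nat.Partition (m : ℕ)) :=
  {x | IsTCore t x.2}

theorem mem_coreSet {t K : ℕ} {x : Σ m : Fin (K + 1), Nat.Partition (m : ℕ)} :
    x ∈ coreSet t K ↔ IsTCore t x.2 := by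
  simp [coreSet]

/-- The generating function of `t`-core partitions of size at most `K`. -/
noncomputable def coreSeries (t K : ℕ) : ℤ⟦X⟧ := ∑ x ∈ coreSet t K, X ^ (x.1 : ℕ)

theorem X_pow_mul_coreSeries {t a K : ℕ} (ht : 1 ≤ t) (ha : 2 * K ≤ a) :
    X ^ (t * a).choose 2 * coreSeries t K =
      ∑ m ∈ Fintype.piFinset (fun _ : Fin t => range (2 * a + 1)) with
        ∑ c, m c = t * a ∧
          ∑ c : Fin t, ((c : ℕ) * m c + t * (m c).choose 2) ≤ (t * a).choose 2 + K,
        X ^ (∑ c : Fin t, ((c : ℕ) * m c + t * (m c).choose 2)) := by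
  have hKM : K ≤ t * a := by nlinarith
  rw [coreSeries, mul_sum]
  simp only [← pow_add, ← sum_beads]
  simp only [← card_beads]
  rw [← sum_image (g := beads) (f := fun s => (X : ℤ⟦X⟧) ^ ∑ x ∈ s, x)
    (beads_injective t).injOn]
  have hcard : ∀ x : (Σ m : Fin (K + 1), Nat.Partition (m : ℕ)), x.2.parts.card ≤ t * a :=
    fun x => (card_parts_le x.2).trans ((Nat.lt_succ_iff.1 x.1.2).trans hKM)
  have hsum : ∀ x : (Σ m : Fin (K + 1), Nat.Partition (m : ℕ)),
      ∑ b ∈ betaSet (t * a) (partitionRow x.2), b = (t * a).choose 2 + x.1 := fun x => by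
    rw [sum_betaSet (partitionRow_antitone _), sum_partitionRow x.2 (hcard x)]
  refine sum_bij (fun x _ => betaSet (t * a) (partitionRow x.2)) ?_ ?_ ?_ ?_
  · intro x hx
    rw [mem_coreSet, isTCore_iff ht x.2 (hcard x)] at hx
    obtain ⟨m, hm⟩ := exists_beads_eq ht hx
    have hc : #(beads m) = t * a := by rw [hm, card_betaSet (partitionRow_antitone _)]
    have hs : ∑ x ∈ beads m, x ≤ (t * a).choose 2 + K := by
      rw [hm, hsum]
      have := x.1.2
      omega
    rw [mem_image]
    refine ⟨m, ?_, hm⟩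
    rw [mem_filter, Fintype.mem_piFinset]
    refine ⟨fun c => ?_, hc, hs⟩
    have := balanced_of_sum_le ha (by rw [← card_beads, hc]) (by rwa [← sum_beads]) c
    rw [mem_range]
    omega
  · intro x _ y _ h
    have h1 := hsum x
    have h2 := hcard x
    have h3 := hcard y
    rw [h, hsum y] at h1
    have h4 := betaSet_injective _ _ _ (partitionRow_antitone _) (partitionRow_antitone _) h
    obtain ⟨n, p⟩ := x
    obtain ⟨n', p'⟩ := y
    obtain rfl : n = n' := Fin.ext (by simp only at h1; omega)
    congr 1
    ext1
    rw [parts_eq_filter p h2, parts_eq_filter p' h3]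
    congr 1
    exact Multiset.map_congr rfl fun i hi => h4 i (Multiset.mem_range.1 hi)
  · intro s hs
    obtain ⟨m, hm, rfl⟩ := mem_image.1 hs
    rw [mem_filter] at hm
    obtain ⟨f, hf, h0, hfm⟩ := exists_betaSet_eq _ _ hm.2.1
    have h1 := sum_betaSet (M := t * a) hf
    rw [hfm] at h1
    have h2 : ∑ i ∈ range (t * a), f i < K + 1 := by have := hm.2.2; omega
    obtain ⟨p, hp, hpf⟩ := exists_partition (n := ((⟨_, h2⟩ : Fin (K + 1)) : ℕ)) hf h0 rfl
    refine ⟨⟨⟨_, h2⟩, p⟩, ?_, ?_⟩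
    · rw [mem_coreSet, isTCore_iff ht _ hp, hpf, hfm]
      exact isFlush_beads m
    · change betaSet (t * a) (partitionRow p) = _
      rw [hpf, hfm]
  · intro x _
    rw [hsum]

theorem X_pow_dvd_coreSeries {t : ℕ} (ht : 1 ≤ t) (K : ℕ) :
    (X : ℤ⟦X⟧) ^ (K + 1) ∣ qPoch X K * coreSeries t K - qPoch (X ^ t) K ^ t := by
  have hX := X_pow_mul_coreSeries (a := 2 * K) ht le_rfl
  have hg := gauss_mul_eq_sum (X : ℤ⟦X⟧) t (2 * (2 * K)) (t * (2 * K))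
  have hE := X_pow_dvd_qPoch_mul_gauss_sub_one (t := 1) (K := K) (m := t * (2 * K))
    (k := t * (2 * K)) le_rfl (by nlinarith) (by nlinarith)
  rw [pow_one, ← two_mul, mul_left_comm] at hE
  set M := t * (2 * K)
  set g := gauss (X : ℤ⟦X⟧) (t * (2 * (2 * K))) M
  set F := qPoch (X ^ t : ℤ⟦X⟧) K
  have hS : (X : ℤ⟦X⟧) ^ (M.choose 2 + (K + 1)) ∣
      X ^ M.choose 2 * coreSeries t K - X ^ M.choose 2 * g * F ^ t := by
    rw [hX, hg, sum_mul, ← filter_filter, sum_filter, ← sum_sub_distrib]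
    refine dvd_sum fun m hm => ?_
    rw [mem_filter] at hm
    have hcard := (card_beads m).trans hm.2
    split_ifs with hw
    · have h1 : M.choose 2 ≤ ∑ c : Fin t, ((c : ℕ) * m c + t * (m c).choose 2) := by
        rw [← sum_beads, ← hcard]
        exact choose_two_le_sum _
      have h2 : (X : ℤ⟦X⟧) ^ (K + 1) ∣ ∏ c, (F * gauss (X ^ t) (2 * (2 * K)) (m c)) - 1 := by
        refine prod_induction _ (fun x => (X : ℤ⟦X⟧) ^ (K + 1) ∣ x - 1) ?_ (by simp) ?_
        · rintro x y ⟨u, hu⟩ ⟨v, hv⟩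
          refine ⟨x * v + u, ?_⟩
          linear_combination x * hv + hu
        · intro c _
          have h3 := balanced_of_sum_le le_rfl hm.2 hw c
          have h4 := X_pow_dvd_qPoch_mul_gauss_sub_one (t := t) (K := K) (m := m c)
            (k := 2 * (2 * K) - m c) ht h3.1 (by omega)
          rwa [show m c + (2 * (2 * K) - m c) = 2 * (2 * K) by omega] at h4
      rw [prod_mul_distrib, prod_const, card_univ, Fintype.card_fin] at h2
      have h5 := mul_dvd_mul (pow_dvd_pow (X : ℤ⟦X⟧) h1) h2
      rw [← pow_add] at h5
      rw [← dvd_neg]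
      convert h5 using 1
      ring
    · rw [zero_sub, dvd_neg, mul_assoc]
      exact Dvd.dvd.mul_right (pow_dvd_pow _ (by omega)) _
  have h6 : (X : ℤ⟦X⟧) ^ M.choose 2 * (qPoch X K * coreSeries t K - F ^ t) =
      qPoch X K * (X ^ M.choose 2 * coreSeries t K - X ^ M.choose 2 * g * F ^ t) +
        X ^ M.choose 2 * (qPoch X K * g - 1) * F ^ t := by ring
  rw [← mul_dvd_mul_iff_left (pow_ne_zero (M.choose 2) X_ne_zero), h6, ← pow_add]
  refine dvd_add (hS.mul_left _) (Dvd.dvd.mul_right ?_ _)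
  rw [pow_add]
  exact mul_dvd_mul_left _ hE

theorem numA_eq_coeff (t k K : ℕ) : (numA t k K : ℤ) = coeff K (coreSeries t K ^ k) := by
  have h : coreSeries t K ^ k = ∏ _i : Fin k, coreSeries t K := by simp
  rw [h]
  simp only [coreSeries]
  rw [prod_univ_sum, map_sum]
  simp only [prod_pow_eq_pow_sum, coeff_X_pow]
  rw [sum_boole, numA, Nat.subtype_card]
  intro f
  simp only [mem_filter, Fintype.mem_piFinset, mem_coreSet]
  rw [and_comm, eq_comm (a := K)]

theorem pow_dvd_coeff_pow {p : ℕ} (hp : p.Prime) (f : ℤ⟦X⟧) (N : ℕ) {j : ℕ} (hj : ¬ p ∣ j) :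
    (p : ℤ) ^ N ∣ coeff j (f ^ p ^ N) := by
  obtain ⟨i, rfl⟩ : ∃ i, j = i + 1 :=
    Nat.exists_eq_succ_of_ne_zero (by rintro rfl; exact hj (dvd_zero _))
  have h := congrArg (coeff i) (derivative_pow f (p ^ N))
  rw [coeff_derivative, mul_assoc, ← map_natCast (C (R := ℤ)), coeff_C_mul] at h
  have h2 : IsCoprime ((p : ℤ) ^ N) ((i : ℤ) + 1) := by
    refine IsCoprime.pow_left ?_
    have := (Nat.Prime.coprime_iff_not_dvd hp).2 hj
    exact_mod_cast Nat.isCoprime_iff_coprime.2 this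
  refine h2.dvd_of_dvd_mul_right ?_
  rw [h, Nat.cast_pow]
  exact dvd_mul_right _ _

theorem dvd_coeff_of_mul {p r d K : ℕ} (D G H : ℤ⟦X⟧) (hG0 : constantCoeff G = 1)
    (hG : ∀ j, ¬ p ∣ j → coeff j G = 0) (hH : ∀ j ≤ K, j ≡ r [MOD p] → (d : ℤ) ∣ coeff j H)
    (h : (X : ℤ⟦X⟧) ^ (K + 1) ∣ D * G - H) :
    ∀ j ≤ K, j ≡ r [MOD p] → (d : ℤ) ∣ coeff j D := by
  intro j
  induction j using Nat.strong_induction_on with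
  | _ j ih =>
    intro hj hjr
    have h1 := X_pow_dvd_iff.1 h j (by omega)
    rw [map_sub, sub_eq_zero, coeff_mul,
      ← add_sum_erase (antidiagonal j) _ (show (j, 0) ∈ antidiagonal j by simp)] at h1
    simp only [coeff_zero_eq_constantCoeff_apply, hG0, mul_one] at h1
    rw [eq_sub_of_add_eq h1]
    refine dvd_sub (hH j hj hjr) (dvd_sum fun x hx => ?_)
    obtain ⟨a, b⟩ := x
    rw [mem_erase, HasAntidiagonal.mem_antidiagonal] at hx
    simp only at hx
    by_cases hb : p ∣ b
    · refine Dvd.dvd.mul_right (ih a ?_ (by omega) ?_) _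
      · have : b ≠ 0 := by
          rintro rfl
          exact hx.1 (by rw [← hx.2, add_zero])
        omega
      · refine Nat.ModEq.trans ?_ hjr
        rw [← hx.2]
        exact ((Nat.modEq_zero_iff_dvd.2 hb).add_left a).symm
    · simp [hG b hb]

theorem coeff_qPoch_pow_eq_zero (p K k : ℕ) : ∀ j, ¬ p ∣ j →
    coeff j (qPoch (X ^ p : ℤ⟦X⟧) K ^ k) = 0 := by
  have hmul : ∀ f g : ℤ⟦X⟧, (∀ j, ¬ p ∣ j → coeff j f = 0) → (∀ j, ¬ p ∣ j → coeff j g = 0) →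
      ∀ j, ¬ p ∣ j → coeff j (f * g) = 0 := by
    intro f g hf hg j hj
    rw [coeff_mul]
    refine sum_eq_zero fun x hx => ?_
    rw [HasAntidiagonal.mem_antidiagonal] at hx
    by_cases h1 : p ∣ x.1
    · rw [hg x.2 (fun h2 => hj (hx ▸ dvd_add h1 h2)), mul_zero]
    · rw [hf x.1 h1, zero_mul]
  have hone : ∀ j, ¬ p ∣ j → coeff j (1 : ℤ⟦X⟧) = 0 := by
    intro j hj
    rw [coeff_one, if_neg]
    rintro rfl
    exact hj (dvd_zero _)
  rw [← card_range k, ← prod_const]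
  refine prod_induction _ (fun f => ∀ j, ¬ p ∣ j → coeff j f = 0) hmul hone fun _ _ => ?_
  refine prod_induction _ (fun f => ∀ j, ¬ p ∣ j → coeff j f = 0) hmul hone fun i _ j hj => ?_
  rw [map_sub, hone j hj, ← pow_mul, coeff_X_pow, if_neg, sub_zero]
  rintro rfl
  exact hj (dvd_mul_right _ _)

theorem ne_choose_two_of_modEq {p r j : ℕ} (hnr : ¬ IsSquare ((8 * r + 1 : ℕ) : ZMod p))
    (hj : j ≡ r [MOD p]) (a : ℕ) : j ≠ (a + 1).choose 2 := by
  rintro rfl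
  apply hnr
  have h1 : 8 * (a + 1).choose 2 + 1 = (2 * a + 1) * (2 * a + 1) := by
    have := two_mul_choose_two a
    nlinarith
  have h2 := (ZMod.natCast_eq_natCast_iff _ _ _).2 ((hj.mul_left 8).add_right 1)
  rw [← h2, h1]
  exact ⟨((2 * a + 1 : ℕ) : ZMod p), by push_cast; ring⟩

theorem stmt_1 (p : ℕ) (hp : p.Prime) (hp5 : 5 ≤ p) (r : ℕ) (hr1 : 1 ≤ r) (hr2 : r ≤ p - 1)
    (hnr : ¬ IsSquare ((8 * r + 1 : ℕ) : ZMod p)) :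
    ∀ n i N : ℕ, 1 ≤ i → 1 ≤ N →
      p ^ N ∣ numA p (p ^ N * i - 3) (p * n + r) := by
  intro n i N hi hN
  set K := p * n + r with hK
  have hpN : p ≤ p ^ N := Nat.le_self_pow (by omega) p
  have hk : p ^ N * i - 3 + 3 = p ^ N * i := Nat.sub_add_cancel (by nlinarith)
  set k := p ^ N * i - 3
  rw [← Int.natCast_dvd_natCast, numA_eq_coeff]
  set A := coreSeries p K
  have hcore := X_pow_dvd_coreSeries (t := p) (by omega) K
  refine dvd_coeff_of_mul (p := p) (r := r) (K := K) (A ^ k) (qPoch (X ^ p) K ^ (p * 3))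
    (A ^ (p ^ N * i) * qPoch X K ^ 3) ?_ (coeff_qPoch_pow_eq_zero p K _) ?_ ?_ K le_rfl ?_
  · have : p ≠ 0 := by omega
    simp [qPoch, this]
  · intro j hj hjr
    rw [coeff_mul]
    refine dvd_sum fun x hx => ?_
    rw [HasAntidiagonal.mem_antidiagonal] at hx
    by_cases h1 : p ∣ x.1
    · have h2 : x.2 ≡ r [MOD p] := by
        refine Nat.ModEq.trans ?_ hjr
        rw [← hx]
        simpa using ((Nat.modEq_zero_iff_dvd.2 h1).add_right x.2).symm
      rw [coeff_qPoch_pow_three (by omega) (ne_choose_two_of_modEq hnr h2), mul_zero]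
      exact dvd_zero _
    · refine Dvd.dvd.mul_right ?_ _
      rw [mul_comm, pow_mul, Nat.cast_pow]
      exact pow_dvd_coeff_pow hp _ N h1
  · rw [← hk, pow_add A, pow_mul, mul_assoc, ← mul_sub, ← mul_pow, ← dvd_neg, ← mul_neg, neg_sub,
      mul_comm A]
    exact (hcore.trans (sub_dvd_pow_sub_pow _ _ 3)).mul_left _
  · rw [hK, Nat.ModEq, Nat.mul_add_mod]
end
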